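/- Let q be a prime power with q ≡ 3 (mod 4) and q ≥ 7, of characteristic p, and let n be an integer with 3 ≤ n ≤ p. If q ≥ (n−1)^2 · 2^{2(n ω(q−1) − 1)}, then 𝔽_q contains n consecutive primitive elements. -/

import Mathlib

open Finset

/-- An element `g` of a finite field is primitive if it generates the multiplicative
group of nonzero elements, i.e. every nonzero element is a power of `g`. -/
def IsPrimitiveElem {F : Type*} [Field F] (g : F) : Prop :=
  ∀ x : F, x ≠ 0 → ∃ k : ℕ, g ^ k = x

/-- The field `F` contains `n` consecutive distinct primitive elements: there is `g`
such that `g, g+1, …, g+n-1` are `n` distinct primitive elements. -/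
def HasConsecutivePrimitives (F : Type*) [Field F] (n : ℕ) : Prop :=
  ∃ g : F, (∀ k : ℕ, k < n → IsPrimitiveElem (g + (k : F))) ∧
    ∀ i : ℕ, i < n → ∀ j : ℕ, j < n → g + (i : F) = g + (j : F) → i = j

open Polynomial

theorem coeff_zero_pow_of_dvd_X_pow_sub_C {L : Type*} [Field L] {a : L} {d : ℕ}
    {h : L[X]} (hm : h.Monic) (hd : h ∣ X ^ d - C a) :
    h.coeff 0 ^ d = ((-1) ^ d * a) ^ h.natDegree := by
  set φ := algebraMap L (AlgebraicClosure L)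
  have hs : (h.map φ).Splits := IsAlgClosed.splits _
  apply φ.injective
  have hm' := hm.map φ
  have h1 := hs.coeff_zero_eq_prod_roots_of_monic hm'
  have hr : ∀ y ∈ (h.map φ).roots, y ^ d = φ a := by
    intro y hy
    have := (mem_roots'.1 hy).2
    have h2 : (h.map φ) ∣ (X ^ d - C a).map φ := Polynomial.map_dvd φ hd
    have := this.dvd h2
    simpa [sub_eq_zero] using this
  have h3 : (h.map φ).roots.prod ^ d = φ a ^ h.natDegree := by
    have h4 : ((h.map φ).roots.map (· ^ d)).prod = (h.map φ).roots.prod ^ d := by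
      simp [Multiset.prod_map_pow]
    rw [← h4, Multiset.map_congr rfl hr]
    simp [← hs.natDegree_eq_card_roots]
  rw [map_pow, ← coeff_map, h1, mul_pow, h3]
  simp only [natDegree_map, map_pow, map_mul, map_neg, map_one, mul_pow]
  rw [← pow_mul, ← pow_mul, mul_comm d, mul_comm]

/-- If `d` divides `e a_i` for all multiplicities `a_i` of the roots of `f` only when `d ∣ e`,
then `f Y ^ d - b` has no common factor with a nonzero polynomial in `Y` of smaller degree. -/
theorem eq_zero_of_resultant_eq_zero {K : Type*} [Field K] {f : K[X]} (hf : f ≠ 0) {b : K}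
    (hb : b ≠ 0) {d : ℕ} (hd : 0 < d)
    (hgcd : ∀ e : ℕ, (∀ c, d ∣ e * f.rootMultiplicity c) → d ∣ e)
    {A : K[X][X]} (hA : A.natDegree < d)
    (hres : resultant A (C f * X ^ d - C (C b)) = 0) : A = 0 := by
  by_contra hA0
  set L := FractionRing K[X]
  set φ : K[X] →+* L := algebraMap K[X] L
  have hφ : Function.Injective φ := IsFractionRing.injective _ _
  have hres' : resultant (A.map φ) ((C f * X ^ d - C (C b)).map φ) = 0 := by
    have := resultant_map_map A (C f * X ^ d - C (C b)) A.natDegree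
      (C f * X ^ d - C (C b)).natDegree φ
    rw [natDegree_map_eq_of_injective hφ, natDegree_map_eq_of_injective hφ, this, hres, map_zero]
  have hnc : ¬ IsCoprime (A.map φ) ((C f * X ^ d - C (C b)).map φ) := by
    intro hc
    exact resultant_ne_zero _ _ hc hres'
  have hf' : φ f ≠ 0 := by simpa using (map_ne_zero_iff φ hφ).2 hf
  set a : L := φ (C b) / φ f
  have hB : (C f * X ^ d - C (C b)).map φ = C (φ f) * (X ^ d - C a) := by
    simp only [Polynomial.map_sub, Polynomial.map_mul, map_C, Polynomial.map_pow, map_X, mul_sub,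
      ← C_mul, a]
    rw [mul_div_cancel₀ _ hf']
  have hA' : A.map φ ≠ 0 := (Polynomial.map_ne_zero_iff hφ).2 hA0
  classical
  set h := normalize (gcd (A.map φ) (X ^ d - C a)) with hh
  have hg0 : gcd (A.map φ) (X ^ d - C a) ≠ 0 := fun H => hA' ((gcd_eq_zero_iff _ _).1 H).1
  have hmon : h.Monic := monic_normalize hg0
  have hh1 : h ∣ A.map φ := (normalize_dvd_iff).2 (gcd_dvd_left _ _)
  have hh2 : h ∣ X ^ d - C a := (normalize_dvd_iff).2 (gcd_dvd_right _ _)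
  have hlt : h.natDegree < d := by
    have := natDegree_le_of_dvd hh1 hA'
    rw [natDegree_map_eq_of_injective hφ] at this
    omega
  have hpos : 0 < h.natDegree := by
    by_contra h0
    have h1 : h = 1 := hmon.natDegree_eq_zero.1 (by omega)
    apply hnc
    rw [hB]
    have hc : IsCoprime (A.map φ) (X ^ d - C a) := by
      rw [← gcd_isUnit_iff]
      rw [hh, normalize_eq_one] at h1
      exact h1
    exact (isCoprime_mul_unit_left_right (isUnit_C.2 (isUnit_iff_ne_zero.2 hf')) _ _).2 hc
  have key := coeff_zero_pow_of_dvd_X_pow_sub_C hmon hh2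
  set e := h.natDegree
  obtain ⟨s, t, ht, hst⟩ := IsFractionRing.div_surjective (A := K[X]) (h.coeff 0)
  have ht0 : t ≠ 0 := nonZeroDivisors.ne_zero ht
  have ht' : φ t ≠ 0 := (map_ne_zero_iff φ hφ).2 ht0
  have key2 : s ^ d * f ^ e = C (((-1) ^ d * b) ^ e) * t ^ d := by
    apply hφ
    rw [← hst, div_pow, div_eq_iff (pow_ne_zero _ ht')] at key
    have ha : φ (C b) = a * φ f := by simp only [a]; rw [div_mul_cancel₀ _ hf']
    rw [map_mul, map_pow, key, map_pow]
    simp only [mul_pow, map_pow, map_neg, map_one, map_mul, ha]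
    ring
  have hs0 : s ≠ 0 := by
    rintro rfl
    rw [zero_pow hd.ne', zero_mul] at key2
    have := (mul_eq_zero.1 key2.symm).resolve_right (pow_ne_zero _ ht0)
    simp [hb] at this
  have : d ∣ e := by
    apply hgcd
    intro c
    have h1 := congrArg (rootMultiplicity c) key2
    have hne : C (((-1) ^ d * b) ^ e) * t ^ d ≠ 0 := by
      rw [← key2]; exact mul_ne_zero (pow_ne_zero _ hs0) (pow_ne_zero _ hf)
    rw [rootMultiplicity_mul hne, rootMultiplicity_mul (key2 ▸ hne), rootMultiplicity_C,
      ← count_roots, ← count_roots, ← count_roots, roots_pow, roots_pow, roots_pow,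
      Multiset.count_nsmul, Multiset.count_nsmul, Multiset.count_nsmul, count_roots f] at h1
    have : d ∣ d * Multiset.count c s.roots + e * rootMultiplicity c f := by
      rw [h1, zero_add]; exact dvd_mul_right _ _
    exact (Nat.dvd_add_right (dvd_mul_right _ _)).1 this
  exact absurd (Nat.le_of_dvd hpos this) (by omega)

theorem natDegree_resultant_le {R : Type*} [CommRing R] (A B : R[X][X]) (m n a b : ℕ)
    (hA : ∀ i, (A.coeff i).natDegree ≤ a) (hB : ∀ i, (B.coeff i).natDegree ≤ b) :
    (resultant A B m n).natDegree ≤ n * a + m * b := by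
  rw [resultant, Matrix.det_apply]
  apply natDegree_sum_le_of_forall_le
  intro σ _
  refine (natDegree_smul_le _ _).trans ?_
  refine (natDegree_prod_le _ _).trans ?_
  have : ∀ i : Fin (m + n), (sylvester A B m n (σ i) i).natDegree ≤
      Fin.addCases (fun _ => b) (fun _ => a) i := by
    intro i
    refine Fin.addCases (fun j => ?_) (fun j => ?_) i
    · simp only [sylvester, Matrix.of_apply, Fin.addCases_left]
      split_ifs <;> simp [hB]
    · simp only [sylvester, Matrix.of_apply, Fin.addCases_right]
      split_ifs <;> simp [hA]
  refine (Finset.sum_le_sum fun i _ => this i).trans ?_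
  rw [Fin.sum_univ_add]
  simp [add_comm]

theorem eq_zero_of_X_pow_dvd_eval {K : Type*} [Field K] {f g : K[X]} (hf : f ≠ 0) {b : K}
    (hb : b ≠ 0) {d : ℕ} (hd : 0 < d)
    (hgcd : ∀ e : ℕ, (∀ c, d ∣ e * f.rootMultiplicity c) → d ∣ e)
    {A : K[X][X]} (hA : A.natDegree < d) {r N : ℕ} (hAr : ∀ i, (A.coeff i).natDegree ≤ r)
    (hN : d * r + d * f.natDegree < N)
    (hg : X ^ N ∣ f * g ^ d - C b) (hAg : X ^ N ∣ A.eval g) : A = 0 := by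
  apply eq_zero_of_resultant_eq_zero hf hb hd hgcd hA
  set B := C f * X ^ d - C (C b) with hBdef
  have hBd : B.natDegree = d := by
    rw [hBdef, natDegree_sub_C, natDegree_C_mul_X_pow _ _ hf]
  have hBc : ∀ i, (B.coeff i).natDegree ≤ f.natDegree := by
    intro i
    simp only [hBdef, coeff_sub, coeff_C_mul, coeff_X_pow, coeff_C]
    refine (natDegree_sub_le _ _).trans ?_
    split_ifs <;> simp
  have hdeg := natDegree_resultant_le A B A.natDegree B.natDegree r f.natDegree hAr hBc
  obtain ⟨p, q, -, -, hpq⟩ := exists_mul_add_mul_eq_C_resultant A B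
    (m := A.natDegree) (n := B.natDegree) le_rfl le_rfl (by omega)
  have hdvd : X ^ N ∣ resultant A B := by
    have h1 := congrArg (eval g) hpq
    rw [eval_C, eval_add, eval_mul, eval_mul] at h1
    rw [← h1]
    refine dvd_add (dvd_mul_of_dvd_left hAg _) (dvd_mul_of_dvd_left ?_ _)
    simpa [hBdef] using hg
  by_contra hne
  have := natDegree_le_of_dvd hdvd hne
  rw [natDegree_X_pow] at this
  have h2 : A.natDegree * f.natDegree ≤ d * f.natDegree := Nat.mul_le_mul_right _ hA.le
  rw [hBd] at hdeg this
  omega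

theorem pow_sub_dvd_hasseDeriv_mul_pow {R : Type*} [CommRing R] (f : R[X]) (s l : ℕ) (r : R[X]) :
    f ^ (s - l) ∣ hasseDeriv l (r * f ^ s) := by
  induction s generalizing l with
  | zero => simp
  | succ s ih =>
    rw [pow_succ', mul_left_comm, hasseDeriv_mul]
    refine Finset.dvd_sum fun x hx => ?_
    obtain ⟨a, b⟩ := x
    rw [HasAntidiagonal.mem_antidiagonal] at hx
    dsimp only at hx ⊢
    rcases Nat.eq_zero_or_pos a with rfl | ha
    · obtain rfl : b = l := by omega
      rw [hasseDeriv_zero']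
      refine dvd_trans (pow_dvd_pow f (by omega : s + 1 - b ≤ (s - b) + 1)) ?_
      rw [pow_succ']
      exact mul_dvd_mul_left _ (ih b)
    · exact dvd_mul_of_dvd_right
        (dvd_trans (pow_dvd_pow f (by omega : s + 1 - l ≤ s - b)) (ih b)) _

/-- The cofactor of `f ^ (s - l)` in the `l`-th Hasse derivative of `r f ^ s`, as a linear function
of `r`. -/
theorem exists_linearMap_hasseDeriv_mul_pow {K : Type*} [Field K] {f : K[X]} (hf : f ≠ 0)
    (s l : ℕ) : ∃ G : K[X] →ₗ[K] K[X],
      ∀ r, hasseDeriv l (r * f ^ s) = f ^ (s - l) * G r := by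
  obtain ⟨G, hG⟩ := LinearMap.exists_leftInverse_of_injective
    (LinearMap.mulLeft K (f ^ (s - l))) (LinearMap.ker_eq_bot.2
      (mul_right_injective₀ (pow_ne_zero _ hf)))
  refine ⟨G ∘ₗ hasseDeriv l ∘ₗ LinearMap.mulRight K (f ^ s), fun r => ?_⟩
  obtain ⟨t, ht⟩ := pow_sub_dvd_hasseDeriv_mul_pow f s l r
  have := LinearMap.congr_fun hG t
  simp only [LinearMap.comp_apply, LinearMap.mulLeft_apply, LinearMap.id_apply,
    LinearMap.mulRight_apply] at this ⊢
  rw [ht, this]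

theorem natDegree_le_of_hasseDeriv_eq {K : Type*} [Field K] {f : K[X]} (hf : f ≠ 0)
    {s l : ℕ} (hl : l ≤ s) {r u : K[X]} (h : hasseDeriv l (r * f ^ s) = f ^ (s - l) * u) :
    u.natDegree ≤ r.natDegree + l * f.natDegree := by
  by_cases hu : u = 0
  · simp [hu]
  have h1 := natDegree_hasseDeriv_le (r * f ^ s) l
  rw [h, natDegree_mul (pow_ne_zero _ hf) hu, natDegree_pow] at h1
  have h2 : (r * f ^ s).natDegree ≤ r.natDegree + s * f.natDegree := by
    refine natDegree_mul_le.trans ?_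
    rw [natDegree_pow]
  obtain ⟨k, rfl⟩ := Nat.exists_eq_add_of_le hl
  rw [Nat.add_sub_cancel_left] at h1
  rw [add_mul] at h2
  omega

/-- In a field with `Q` elements, `∑ r_ij X ^ (Q i) g ^ j` with `g = f ^ ((Q - 1) / d)` vanishes
only if all the `r_ij` do, provided their degrees are small. -/
theorem eq_zero_of_sum_mul_X_pow_eq_zero {K : Type*} [Field K] [Fintype K] {f : K[X]}
    (h0 : f.eval 0 ≠ 0) {d : ℕ} (hd : 0 < d)
    (hgcd : ∀ e : ℕ, (∀ c, d ∣ e * f.rootMultiplicity c) → d ∣ e)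
    {E R : ℕ} (hE : d * E + 1 = Fintype.card K) (hR : R + f.natDegree ≤ E)
    {I : ℕ} (r : Fin d → Fin I → K[X]) (hr : ∀ j i, (r j i).natDegree ≤ R)
    (h : ∑ j : Fin d, ∑ i : Fin I,
      r j i * X ^ (Fintype.card K * i) * (f ^ E) ^ (j : ℕ) = 0) : r = 0 := by
  have hf : f ≠ 0 := by rintro rfl; simp at h0
  set Q := Fintype.card K
  have hg : X ^ Q ∣ f * (f ^ E) ^ d - C (f.eval 0) := by
    have h1 : f * (f ^ E) ^ d = f ^ Q := by
      rw [← pow_mul, ← pow_succ', mul_comm E d, hE]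
    rw [h1, ← FiniteField.expand_card f]
    have h2 : (X : K[X]) ∣ f - C (f.eval 0) := by
      rw [X_dvd_iff, coeff_sub, coeff_C_zero, coeff_zero_eq_eval_zero, sub_self]
    have := map_dvd (expand K Q) h2
    rwa [map_sub, expand_X, expand_C] at this
  suffices H : ∀ n : ℕ, ∀ i : Fin I, (i : ℕ) = n → ∀ j, r j i = 0 by
    funext j i
    exact H i i rfl j
  intro n
  induction n using Nat.strong_induction_on with
  | _ n ih =>
  intro i₀ hi₀ j₀
  set A : K[X][X] := ∑ j : Fin d, C (r j i₀) * X ^ (j : ℕ) with hA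
  have hAd : A.natDegree < d := by
    refine Nat.lt_of_le_pred hd (natDegree_sum_le_of_forall_le _ _ fun j _ => ?_)
    refine (natDegree_C_mul_X_pow_le _ _).trans ?_
    have := j.2
    rw [Nat.pred_eq_sub_one]
    omega
  have hAc : ∀ j : Fin d, A.coeff j = r j i₀ := by
    intro j
    simp [hA, coeff_X_pow, Fin.val_inj]
  have hAc' : ∀ i, (A.coeff i).natDegree ≤ R := by
    intro i
    by_cases hi : i < d
    · exact (hAc ⟨i, hi⟩) ▸ hr _ _
    · rw [coeff_eq_zero_of_natDegree_lt (by omega)]; simp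
  have hA0 : A = 0 := by
    refine eq_zero_of_X_pow_dvd_eval hf h0 hd hgcd hAd hAc' (N := Q) ?_ hg ?_
    · rw [← mul_add]
      have := Nat.mul_le_mul_left d hR
      omega
    · have hX : (X : K[X]) ^ (Q * n) ≠ 0 := pow_ne_zero _ X_ne_zero
      rw [← mul_dvd_mul_iff_left hX, ← pow_add]
      have h3 : X ^ (Q * n) * A.eval (f ^ E) = - ∑ j : Fin d, ∑ i ∈ univ.erase i₀,
          r j i * X ^ (Q * i) * (f ^ E) ^ (j : ℕ) := by
        rw [eq_neg_iff_add_eq_zero, ← h, hA, eval_finsetSum, mul_sum, ← sum_add_distrib]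
        refine sum_congr rfl fun j _ => ?_
        rw [← add_sum_erase _ _ (mem_univ i₀), hi₀]
        simp only [eval_mul, eval_C, eval_pow, eval_X]
        ring
      rw [h3, dvd_neg]
      refine dvd_sum fun j _ => dvd_sum fun i hi => ?_
      rcases lt_trichotomy (i : ℕ) n with hlt | heq | hgt
      · rw [ih i hlt i rfl j]; simp
      · exact absurd (Fin.ext (heq.trans hi₀.symm)) (ne_of_mem_erase hi)
      · refine dvd_mul_of_dvd_left (dvd_mul_of_dvd_right (pow_dvd_pow _ ?_) _) _
        calc Q * n + Q = Q * (n + 1) := by ring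
          _ ≤ Q * i := Nat.mul_le_mul_left _ hgt
  rw [← hAc j₀, hA0, coeff_zero]

theorem exists_auxiliary_coefficients {K : Type*} [Field K] {d I R M B : ℕ}
    (G : Fin M → Fin d → K[X] →ₗ[K] K[X]) (v : K) (hlt : M * B < d * (I * R))
    (hG : ∀ l j (r : K[X]), r.natDegree ≤ R → (G l j r).natDegree + I ≤ B) :
    ∃ r : Fin d → Fin I → K[X], r ≠ 0 ∧ (∀ j i, (r j i).natDegree ≤ R) ∧
      ∀ l, ∑ j : Fin d, ∑ i : Fin I, C (v ^ (j : ℕ)) * X ^ (i : ℕ) * G l j (r j i) = 0 := by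
  let Z : Fin M → (Fin d → Fin I → degreeLT K R) →ₗ[K] K[X] := fun l =>
    ∑ j : Fin d, ∑ i : Fin I, LinearMap.mulLeft K (C (v ^ (j : ℕ)) * X ^ (i : ℕ)) ∘ₗ G l j ∘ₗ
      (degreeLT K R).subtype ∘ₗ LinearMap.proj i ∘ₗ LinearMap.proj j
  let T : (Fin d → Fin I → degreeLT K R) →ₗ[K] (Fin M → Fin B → K) :=
    LinearMap.pi fun l => LinearMap.pi fun b => lcoeff K b ∘ₗ Z l
  have e := degreeLTEquiv K R
  have : FiniteDimensional K (degreeLT K R) := Module.Finite.equiv e.symm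
  have hfin : Module.finrank K (degreeLT K R) = R := by rw [e.finrank_eq]; simp
  have hker : LinearMap.ker T ≠ ⊥ := by
    apply LinearMap.ker_ne_bot_of_finrank_lt
    simp only [Module.finrank_pi_fintype, hfin, Module.finrank_self]
    simpa using hlt
  obtain ⟨r, hr, hr0⟩ := (Submodule.ne_bot_iff _).1 hker
  have hdeg : ∀ j i, (r j i : K[X]).natDegree ≤ R := fun j i =>
    natDegree_le_of_degree_le (mem_degreeLT.1 (r j i).2).le
  refine ⟨fun j i => r j i, ?_, hdeg, fun l => ?_⟩
  · intro h
    apply hr0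
    funext j i
    exact Subtype.ext (congrFun (congrFun h j) i)
  · have hZ : Z l r = ∑ j : Fin d, ∑ i : Fin I,
        C (v ^ (j : ℕ)) * X ^ (i : ℕ) * G l j (r j i) := by
      simp [Z, mul_assoc]
    rw [← hZ]
    ext b
    rw [coeff_zero]
    by_cases hb : b < B
    · exact congrFun (congrFun (LinearMap.mem_ker.1 hr) l) ⟨b, hb⟩
    · rw [hZ, finsetSum_coeff]
      refine sum_eq_zero fun j _ => ?_
      rw [finsetSum_coeff]
      refine sum_eq_zero fun i _ => ?_
      rw [mul_assoc, coeff_C_mul, coeff_X_pow_mul']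
      have h1 := hG l j (r j i) (hdeg j i)
      have := i.2
      rw [if_pos (by omega), coeff_eq_zero_of_natDegree_lt (by omega), mul_zero]

/-- Stepanov's method: a bound for the number of solutions of `f x ^ ((Q - 1) / d) = v`. -/
theorem card_filter_eval_pow_eq_le {K : Type*} [Field K] [Fintype K] [DecidableEq K] {f : K[X]}
    (h0 : f.eval 0 ≠ 0) {d : ℕ} (hd : 0 < d)
    (hgcd : ∀ e : ℕ, (∀ c, d ∣ e * f.rootMultiplicity c) → d ∣ e)
    {E R : ℕ} (hE : d * E + 1 = Fintype.card K) (hR : R + f.natDegree ≤ E) {M I : ℕ}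
    (hM : M ≤ Fintype.card K)
    (hMI : M * (R + M * f.natDegree + I) < d * (I * R)) (v : K) :
    #{x : K | f.eval x ^ E = v} * M ≤
      M * f.natDegree + R + Fintype.card K * I + Fintype.card K * f.natDegree := by
  have hf : f ≠ 0 := by rintro rfl; simp at h0
  set Q := Fintype.card K with hQ
  choose G hG using fun (l : Fin M) (j : Fin d) =>
    exists_linearMap_hasseDeriv_mul_pow hf (M + j * E) l
  obtain ⟨r, hr0, hrd, hr⟩ := exists_auxiliary_coefficients (I := I) (R := R)
    (B := R + M * f.natDegree + I) G v hMI (by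
      intro l j r hr
      have := natDegree_le_of_hasseDeriv_eq hf (by omega) (hG l j r)
      have h2 : (l : ℕ) * f.natDegree ≤ M * f.natDegree := Nat.mul_le_mul_right _ l.2.le
      omega)
  set S := ∑ j : Fin d, ∑ i : Fin I, r j i * X ^ (Q * i) * (f ^ E) ^ (j : ℕ) with hS
  have hS0 : S ≠ 0 := fun h => hr0 (eq_zero_of_sum_mul_X_pow_eq_zero h0 hd hgcd hE hR r hrd h)
  have hP0 : f ^ M * S ≠ 0 := mul_ne_zero (pow_ne_zero _ hf) hS0
  have hdvd : ∀ x ∈ ({x : K | f.eval x ^ E = v} : Finset K), (X - C x) ^ M ∣ f ^ M * S := by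
    intro x hx
    have hxv : f.eval x ^ E = v := by simpa using hx
    have ht : X ^ M ∣ taylor x (f ^ M * S) := by
      have h1 : taylor x (f ^ M * S) = ∑ j : Fin d, ∑ i : Fin I,
          taylor x (r j i * f ^ (M + j * E)) * (X ^ Q + C x) ^ (i : ℕ) := by
        rw [hS, mul_sum, map_sum]
        refine sum_congr rfl fun j _ => ?_
        rw [mul_sum, map_sum]
        refine sum_congr rfl fun i _ => ?_
        have : taylor x (X ^ Q : K[X]) = X ^ Q + C x := by
          rw [taylor_pow, taylor_X, hQ, ← FiniteField.expand_card, map_add, expand_X, expand_C]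
        rw [← this, ← taylor_pow, ← taylor_mul]
        congr 1
        rw [pow_add, ← pow_mul, ← pow_mul, mul_comm (j : ℕ) E]
        ring
      have h2 : X ^ M ∣ taylor x (f ^ M * S) - ∑ j : Fin d, ∑ i : Fin I,
          taylor x (r j i * f ^ (M + j * E)) * C x ^ (i : ℕ) := by
        rw [h1, ← sum_sub_distrib]
        refine dvd_sum fun j _ => ?_
        rw [← sum_sub_distrib]
        refine dvd_sum fun i _ => ?_
        rw [← mul_sub]
        refine dvd_mul_of_dvd_right ?_ _
        refine dvd_trans ?_ (sub_dvd_pow_sub_pow _ _ _)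
        rw [add_sub_cancel_right]
        exact pow_dvd_pow _ hM
      refine (dvd_iff_dvd_of_dvd_sub h2).2 ?_
      rw [X_pow_dvd_iff]
      intro l hl
      have h3 := congrArg (eval x) (hr ⟨l, hl⟩)
      rw [finsetSum_coeff]
      calc ∑ j : Fin d, (∑ i : Fin I,
            taylor x (r j i * f ^ (M + j * E)) * C x ^ (i : ℕ)).coeff l
          = ∑ j : Fin d, ∑ i : Fin I, f.eval x ^ (M - l) *
              (v ^ (j : ℕ) * x ^ (i : ℕ) * (G ⟨l, hl⟩ j (r j i)).eval x) := by
            refine sum_congr rfl fun j _ => ?_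
            rw [finsetSum_coeff]
            refine sum_congr rfl fun i _ => ?_
            rw [← C_pow, coeff_mul_C, taylor_coeff, hG ⟨l, hl⟩ j (r j i), eval_mul, eval_pow]
            have : M + (j : ℕ) * E - l = (M - l) + E * j := by
              rw [mul_comm E]; omega
            rw [this, pow_add, pow_mul, hxv]
            ring
        _ = f.eval x ^ (M - l) * eval x (∑ j : Fin d, ∑ i : Fin I,
              C (v ^ (j : ℕ)) * X ^ (i : ℕ) * G ⟨l, hl⟩ j (r j i)) := by
            simp only [eval_finsetSum, mul_sum, eval_mul, eval_C, eval_pow, eval_X]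
        _ = 0 := by rw [hr]; simp
    have h4 := map_dvd (taylorAlgHom (-x)) ht
    simpa [taylor_taylor, sub_eq_add_neg] using h4
  have hprod : ∏ x ∈ ({x : K | f.eval x ^ E = v} : Finset K), (X - C x) ^ M ∣ f ^ M * S := by
    apply Finset.prod_dvd_of_coprime
    · intro x _ y _ hxy
      exact (pairwise_coprime_X_sub_C Function.injective_id hxy).pow
    · exact hdvd
  have h5 := natDegree_le_of_dvd hprod hP0
  rw [natDegree_prod_of_monic _ _ fun x _ => (monic_X_sub_C x).pow M] at h5
  simp only [natDegree_pow, natDegree_X_sub_C, mul_one, sum_const, smul_eq_mul] at h5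
  refine h5.trans (natDegree_mul_le.trans ?_)
  rw [natDegree_pow]
  have h6 : S.natDegree ≤ R + Q * I + Q * f.natDegree := by
    refine natDegree_sum_le_of_forall_le _ _ fun j _ => natDegree_sum_le_of_forall_le _ _
      fun i _ => ?_
    refine natDegree_mul_le.trans (Nat.add_le_add (natDegree_mul_le.trans
      (Nat.add_le_add (hrd j i) ?_)) ?_)
    · rw [natDegree_X_pow]; exact Nat.mul_le_mul_left _ i.2.le
    · rw [← pow_mul, natDegree_pow]
      apply Nat.mul_le_mul_right
      have := Nat.mul_le_mul_left E j.2.le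
      rw [mul_comm E d] at this
      omega
  omega

theorem mul_le_add_mul_sqrt_of_stepanov {d D Q E N : ℕ} (hd : 0 < d) (hE : d * E + 1 = Q)
    (hNQ : N ≤ Q)
    (H : ∀ R M I : ℕ, R + D ≤ E → M ≤ Q → M * (R + M * D + I) < d * (I * R) →
      N * M ≤ M * D + R + Q * I + Q * D) :
    ∃ C₀ : ℕ, C₀ = d * D + 4 * (d * (d * D + 2) + D + 1) +
      d * (d * (d * D + 2) + (d * D + 2) * (d * D + 1) + 1) ∧
      (d * N : ℝ) ≤ Q + C₀ * √Q := by
  refine ⟨_, rfl, ?_⟩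
  set w := d * D + 1 with hw
  set c := d * (d * D + 2) with hc
  set s₀ := c + (d * D + 2) * w + 1 with hs₀
  set s := Nat.sqrt Q with hs
  have hs1 : s * s ≤ Q := Nat.sqrt_le Q
  have hs2 : Q < (s + 1) * (s + 1) := Nat.lt_succ_sqrt Q
  have hsR : (s : ℝ) ≤ √Q := by
    apply Real.le_sqrt_of_sq_le
    rw [sq]; exact_mod_cast hs1
  have hQ0 : (0 : ℝ) ≤ Q := Nat.cast_nonneg _
  have hsq : √(Q : ℝ) * √Q = Q := Real.mul_self_sqrt hQ0
  have hsq0 : 0 ≤ √(Q : ℝ) := Real.sqrt_nonneg _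
  have hQ1 : (1 : ℝ) ≤ Q := by exact_mod_cast (by omega : 1 ≤ Q)
  have hsq1 : 1 ≤ √(Q : ℝ) := Real.one_le_sqrt.2 hQ1
  by_cases hlt : s < s₀
  · have h1 : √(Q : ℝ) ≤ s₀ := by
      rw [Real.sqrt_le_left (by positivity), sq]
      have : Q ≤ s₀ * s₀ := hs2.le.trans (Nat.mul_le_mul hlt hlt)
      exact_mod_cast this
    have h2 : (N : ℝ) ≤ Q := by exact_mod_cast hNQ
    have h3 : (d * N : ℝ) ≤ d * s₀ * √Q := by
      calc (d * N : ℝ) ≤ d * (√Q * √Q) := by rw [hsq]; gcongr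
        _ ≤ d * (s₀ * √Q) := by gcongr
        _ = _ := by ring
    have h4 : (0 : ℝ) ≤ (d * D + 4 * (c + D + 1) : ℕ) * √Q := by positivity
    push_cast at h3 h4 ⊢
    nlinarith
  · push Not at hlt
    have hdc : d ≤ c := Nat.le_mul_of_pos_right _ (by omega)
    have hds : d * s ≤ Q := (Nat.mul_le_mul_right s (by omega : d ≤ s)).trans hs1
    have hbig : s * c + (d * D + 2) * w < Q := by
      have h1 : s * c + (d * D + 2) * w + 1 ≤ s * s₀ := by
        have h2 : 1 * ((d * D + 2) * w + 1) ≤ s * ((d * D + 2) * w + 1) :=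
          Nat.mul_le_mul_right _ (by omega)
        have h3 : s * s₀ = s * c + s * ((d * D + 2) * w + 1) := by rw [hs₀]; ring
        rw [h3]
        omega
      have h2 : s * s₀ ≤ s * s := Nat.mul_le_mul_left _ hlt
      omega
    have hDE : D ≤ E := by
      have h1 : w ≤ (d * D + 2) * w := Nat.le_mul_of_pos_left _ (by omega)
      have : d * D ≤ d * E := by omega
      exact Nat.le_of_mul_le_mul_left this hd
    obtain ⟨R, rfl⟩ := Nat.exists_eq_add_of_le hDE
    have key := H R (d * s) (s + c) (by omega) hds (by
      rw [mul_assoc]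
      apply Nat.mul_lt_mul_of_pos_left _ hd
      have h1 : d * R + w = Q := by rw [← hE, hw]; ring
      apply Nat.lt_of_mul_lt_mul_left (a := d)
      have h2 : d * (s * (R + d * s * D + (s + c))) =
        s * (d * R) + d * (s * s * w) + d * (s * c) := by rw [hw]; ring
      have h3 : d * ((s + c) * R) = s * (d * R) + c * (d * R) := by ring
      rw [h2, h3]
      have h4 : d * (s * s * w) ≤ d * (Q * w) := by gcongr
      have h5 : c * (d * R) + d * ((d * D + 2) * w) = d * (w * Q + Q) := by
        rw [← h1, hc, hw]; ring
      have h6 : d * (s * c + (d * D + 2) * w) < d * Q := Nat.mul_lt_mul_of_pos_left hbig hd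
      have h7 : d * (w * Q + Q) = d * (Q * w) + d * Q := by ring
      have h8 : d * (s * c + (d * D + 2) * w) = d * (s * c) + d * ((d * D + 2) * w) := by ring
      omega)
    have hspos : 0 < s := by omega
    have hR : R ≤ Q := by
      have : R ≤ d * (D + R) := by nlinarith
      omega
    have h1 : s * (d * N) ≤ s * (d * D + Q + (c + D + 1) * (4 * s)) := by
      have h2 : Q ≤ 4 * s * s := by nlinarith
      have h3 : Q * (c + D + 1) ≤ 4 * s * s * (c + D + 1) := by gcongr
      nlinarith
    have h2 := Nat.le_of_mul_le_mul_left h1 hspos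
    have h3 : (d * N : ℝ) ≤ d * D + Q + (c + D + 1) * (4 * s) := by exact_mod_cast h2
    have h4 : (d * D : ℝ) ≤ d * D * √Q := le_mul_of_one_le_right (by positivity) hsq1
    have h5 : (c + D + 1 : ℝ) * (4 * s) ≤ (c + D + 1) * (4 * √Q) := by gcongr
    have h6 : (0 : ℝ) ≤ (d * s₀ : ℕ) * √Q := by positivity
    push_cast at h6 ⊢
    nlinarith

theorem MulChar.norm_apply_le_one {F : Type*} [Field F] [Finite F] (χ : MulChar F ℂ) (x : F) :
    ‖χ x‖ ≤ 1 := by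
  by_cases hx : x = 0
  · simp [hx]
  · have := Fintype.ofFinite F
    have h : χ x ^ (Fintype.card F - 1) = 1 := by
      rw [← map_pow, FiniteField.pow_card_sub_one_eq_one x hx, map_one]
    exact (Complex.norm_eq_one_of_pow_eq_one h
      (Nat.sub_ne_zero_of_lt Fintype.one_lt_card)).le

theorem MulChar.apply_eq_of_pow_eq {K : Type*} [Field K] [Fintype K] {Ψ : MulChar K ℂ}
    {d E : ℕ} (hE : d * E + 1 = Fintype.card K) (hΨ : Ψ ^ d = 1) {y z : Kˣ}
    (h : y ^ E = z ^ E) : Ψ y = Ψ z := by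
  classical
  obtain ⟨γ, hγ⟩ := IsCyclic.exists_generator (α := Kˣ)
  have ho : orderOf γ = d * E := by
    rw [orderOf_eq_card_of_forall_mem_zpowers hγ, Nat.card_eq_fintype_card, Fintype.card_units]
    omega
  have hE0 : E ≠ 0 := by
    rintro rfl
    have := Fintype.one_lt_card (α := K)
    omega
  obtain ⟨k, hk⟩ := Subgroup.mem_zpowers_iff.1 (hγ (y / z))
  have h1 : γ ^ (k * E) = 1 := by
    rw [zpow_mul, hk, zpow_natCast, div_pow, h, div_self']
  have h2 : (d : ℤ) ∣ k := by
    have := orderOf_dvd_iff_zpow_eq_one.2 h1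
    rw [ho] at this
    push_cast at this
    exact Int.dvd_of_mul_dvd_mul_right (by exact_mod_cast hE0) this
  obtain ⟨m, rfl⟩ := h2
  have h3 : y = z * (γ ^ m) ^ d := by
    rw [← zpow_natCast, ← zpow_mul, mul_comm m, hk, mul_div_cancel]
  rw [h3, Units.val_mul, map_mul, Units.val_pow_eq_pow_val, map_pow]
  have h4 : Ψ (γ ^ m : Kˣ) ^ d = 1 := by
    rw [← MulChar.pow_apply_coe, hΨ, MulChar.one_apply_coe]
  rw [h4, mul_one]

theorem card_units_pow_eq_pow {K : Type*} [Field K] [Fintype K] [DecidableEq K] {d E : ℕ}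
    (hE : d * E + 1 = Fintype.card K) (a : Kˣ) : #{y : Kˣ | y ^ E = a ^ E} = E := by
  have h1 := IsCyclic.card_powMonoidHom_ker (G := Kˣ) E
  rw [Nat.card_eq_fintype_card, Nat.card_eq_fintype_card, Fintype.card_units,
    Nat.gcd_eq_right (Dvd.intro_left d (by omega))] at h1
  rw [← Fintype.card_coe]
  refine (Fintype.card_congr ((Equiv.divRight a).subtypeEquiv fun y => ?_)).trans h1
  simp [MonoidHom.mem_ker, div_pow, div_eq_one]

theorem norm_sum_mulChar_eval_le {K : Type*} [Field K] [Fintype K] {f : K[X]}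
    (h0 : f.eval 0 ≠ 0) {d : ℕ} (hd : 0 < d) (hdK : d ∣ Fintype.card K - 1)
    (hgcd : ∀ e : ℕ, (∀ c, d ∣ e * f.rootMultiplicity c) → d ∣ e)
    {Ψ : MulChar K ℂ} (hΨ : Ψ ^ d = 1) (hΨ1 : Ψ ≠ 1) :
    ∃ C₀ : ℕ, C₀ = d * f.natDegree + 4 * (d * (d * f.natDegree + 2) + f.natDegree + 1) +
      d * (d * (d * f.natDegree + 2) + (d * f.natDegree + 2) * (d * f.natDegree + 1) + 1) ∧
    ‖∑ x, Ψ (f.eval x)‖ ≤ (C₀ + f.natDegree : ℕ) * √(Fintype.card K) := by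
  classical
  obtain ⟨E, hE⟩ := hdK
  have hcard := Fintype.one_lt_card (α := K)
  replace hE : d * E + 1 = Fintype.card K := by omega
  refine ⟨_, rfl, ?_⟩
  set C₀ := d * f.natDegree + 4 * (d * (d * f.natDegree + 2) + f.natDegree + 1) +
      d * (d * (d * f.natDegree + 2) + (d * f.natDegree + 2) * (d * f.natDegree + 1) + 1)
  set Q := Fintype.card K with hQ
  have hf : f ≠ 0 := by rintro rfl; simp at h0
  have hE0 : E ≠ 0 := by rintro rfl; omega
  have hER : (0 : ℝ) < E := by positivity
  have hdR : (0 : ℝ) < d := by positivity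
  let N : K → ℕ := fun v => #{x : K | f.eval x ^ E = v}
  set B : ℝ := (Q + C₀ * √Q) / d with hB
  have hN : ∀ v, (N v : ℝ) ≤ B := by
    intro v
    obtain ⟨c, hc, h⟩ := mul_le_add_mul_sqrt_of_stepanov (N := N v) (D := f.natDegree) hd hE
      (card_le_univ _) fun R M I hR hM hMI =>
        card_filter_eval_pow_eq_le h0 hd hgcd hE hR hM hMI v
    rw [hB, le_div_iff₀ hdR, mul_comm]
    rwa [hc] at h
  have hfib : ∀ (φ : Kˣ → ℂ), (∀ y z : Kˣ, y ^ E = z ^ E → φ y = φ z) →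
      ∀ ψ : K → ℂ, (∀ y : Kˣ, ψ y = φ y) → ψ 0 = 0 →
      E * ∑ x, ψ (f.eval x) = ∑ y : Kˣ, φ y * N ((y : K) ^ E) := by
    intro φ hφ ψ hψ hψ0
    have h1 : ∀ x : K, E * ψ (f.eval x) =
        ∑ y : Kˣ, if f.eval x ^ E = (y : K) ^ E then φ y else 0 := by
      intro x
      by_cases hx : f.eval x = 0
      · rw [hx, hψ0, mul_zero, eq_comm]
        refine sum_eq_zero fun y _ => if_neg ?_
        rw [zero_pow hE0]
        exact (pow_ne_zero _ y.ne_zero).symm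
      · have h2 : ∀ y : Kˣ, f.eval x ^ E = (y : K) ^ E ↔ y ^ E = Units.mk0 _ hx ^ E := by
          intro y
          rw [Units.ext_iff]
          simp [eq_comm]
        simp only [h2]
        rw [← sum_filter, sum_congr rfl fun y hy => hφ y _ (mem_filter.1 hy).2, sum_const,
          card_units_pow_eq_pow hE, nsmul_eq_mul, ← hψ, Units.val_mk0]
    rw [mul_sum, sum_congr rfl fun x _ => h1 x, sum_comm]
    refine sum_congr rfl fun y _ => ?_
    rw [← sum_filter, sum_const, nsmul_eq_mul, mul_comm]
  have hS := hfib (fun y => Ψ y) (fun y z h => MulChar.apply_eq_of_pow_eq hE hΨ h) Ψ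
    (fun _ => rfl) (MulChar.map_zero Ψ)
  have hS1 := hfib (fun _ => 1) (fun _ _ _ => rfl) (fun x => if x = 0 then 0 else 1)
    (by simp) (by simp)
  have hsum0 : ∑ y : Kˣ, Ψ y = 0 := by
    obtain ⟨b, hb⟩ := MulChar.ne_one_iff.1 hΨ1
    refine eq_zero_of_mul_eq_self_left hb ?_
    rw [mul_sum, ← Equiv.sum_comp (Equiv.mulLeft b) fun y : Kˣ => Ψ y]
    simp
  have hroots : (Q : ℝ) - f.natDegree ≤ #{x : K | f.eval x ≠ 0} := by
    have h1 : #{x : K | f.eval x = 0} ≤ f.natDegree := by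
      refine le_trans (card_le_card ?_) ((Multiset.toFinset_card_le _).trans (card_roots' f))
      intro x hx
      simpa [hf] using hx
    have h2 := card_filter_add_card_filter_not (s := (univ : Finset K)) (fun x => f.eval x = 0)
    have : Q ≤ f.natDegree + #{x : K | f.eval x ≠ 0} := by
      rw [hQ, ← card_univ, ← h2]
      gcongr
    have : (Q : ℝ) ≤ f.natDegree + #{x : K | f.eval x ≠ 0} := by exact_mod_cast this
    linarith
  have hcount : (E : ℝ) * #{x : K | f.eval x ≠ 0} = ∑ y : Kˣ, (N ((y : K) ^ E) : ℝ) := by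
    have : ∑ x, (if f.eval x = 0 then (0 : ℂ) else 1) = #{x : K | f.eval x ≠ 0} := by
      rw [← sum_boole]
      refine sum_congr rfl fun x _ => ?_
      by_cases hx : f.eval x = 0 <;> simp [hx]
    rw [this] at hS1
    simp only [one_mul] at hS1
    exact_mod_cast hS1
  have hbound : (E : ℝ) * ‖∑ x, Ψ (f.eval x)‖ ≤ E * (d * B - (Q - f.natDegree)) := by
    calc (E : ℝ) * ‖∑ x, Ψ (f.eval x)‖ = ‖(E : ℂ) * ∑ x, Ψ (f.eval x)‖ := by simp
      _ = ‖∑ y : Kˣ, Ψ y * ((N ((y : K) ^ E) : ℂ) - B)‖ := by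
          rw [hS]
          simp only [mul_sub, sum_sub_distrib, ← sum_mul, hsum0, zero_mul, sub_zero]
      _ ≤ ∑ y : Kˣ, (B - N ((y : K) ^ E)) := by
          refine norm_sum_le_of_le _ fun y _ => ?_
          rw [norm_mul]
          have h1 := MulChar.norm_apply_le_one Ψ (y : K)
          have h2 : ‖(N ((y : K) ^ E) : ℂ) - B‖ = B - N ((y : K) ^ E) := by
            rw [← Complex.ofReal_natCast, ← Complex.ofReal_sub, Complex.norm_real,
              Real.norm_eq_abs, abs_sub_comm, abs_of_nonneg (sub_nonneg.2 (hN _))]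
          rw [h2]
          exact mul_le_of_le_one_left (sub_nonneg.2 (hN _)) h1
      _ = (d * E) * B - E * #{x : K | f.eval x ≠ 0} := by
          rw [sum_sub_distrib, ← hcount, sum_const, card_univ, Fintype.card_units, ← hQ, ← hE]
          simp
      _ ≤ E * (d * B - (Q - f.natDegree)) := by
          have := mul_le_mul_of_nonneg_left hroots hER.le
          linarith
  have h1 := le_of_mul_le_mul_left hbound hER
  have h2 : d * B = Q + C₀ * √Q := by rw [hB]; field_simp
  have h3 : 1 ≤ √(Q : ℝ) := Real.one_le_sqrt.2 (by exact_mod_cast hcard.le)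
  have h4 : (f.natDegree : ℝ) ≤ f.natDegree * √Q := le_mul_of_one_le_right (by positivity) h3
  rw [h2] at h1
  push_cast
  linarith

theorem finite_setOf_monic_natDegree_eq (F : Type*) [Field F] [Finite F] (m : ℕ) :
    {h : F[X] | h.Monic ∧ h.natDegree = m}.Finite := by
  have : Finite (degreeLT F (m + 1)) := Finite.of_equiv _ (degreeLTEquiv F (m + 1)).symm.toEquiv
  refine Set.Finite.subset (Set.toFinite (degreeLT F (m + 1) : Set F[X])) ?_
  rintro h ⟨h1, h2⟩
  rw [SetLike.mem_coe, mem_degreeLT, degree_eq_natDegree h1.ne_zero, h2]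
  exact_mod_cast Nat.lt_succ_self m

/-- The finite set of monic polynomials of a given degree over a finite field. -/
noncomputable def monicsOfDegree (F : Type*) [Field F] [Finite F] (m : ℕ) : Finset F[X] :=
  (finite_setOf_monic_natDegree_eq F m).toFinset

theorem mem_monicsOfDegree {F : Type*} [Field F] [Finite F] {m : ℕ} {h : F[X]} :
    h ∈ monicsOfDegree F m ↔ h.Monic ∧ h.natDegree = m := by
  simp [monicsOfDegree]

theorem monicsOfDegree_zero (F : Type*) [Field F] [Finite F] : monicsOfDegree F 0 = {1} := by
  ext h
  rw [mem_monicsOfDegree, mem_singleton]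
  constructor
  · rintro ⟨h1, h2⟩
    exact h1.natDegree_eq_zero.1 h2
  · rintro rfl
    exact ⟨monic_one, natDegree_one⟩

theorem monicsOfDegree_one (F : Type*) [Field F] [Fintype F] [DecidableEq F[X]] :
    monicsOfDegree F 1 = univ.image fun x : F => X - C x := by
  ext h
  simp only [mem_monicsOfDegree, mem_image, mem_univ, true_and]
  constructor
  · rintro ⟨h1, h2⟩
    refine ⟨-h.coeff 0, ?_⟩
    rw [h1.eq_X_add_C h2]
    simp
  · rintro ⟨x, rfl⟩
    exact ⟨monic_X_sub_C x, natDegree_X_sub_C x⟩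

/-- The sum of `χ h` over the monic polynomials `h` of degree `m`. -/
noncomputable def sumMonics {F : Type*} [Field F] [Finite F] (χ : F[X] →* ℂ) (m : ℕ) : ℂ :=
  ∑ h ∈ monicsOfDegree F m, χ h

open Classical in
/-- The sum of `deg P * χ P ^ e` over the monic irreducible polynomials `P` and the integers
`e` with `e * deg P = k`. -/
noncomputable def sumIrreducibles {F : Type*} [Field F] [Finite F] (χ : F[X] →* ℂ) (k : ℕ) : ℂ :=
  ∑ x ∈ k.divisorsAntidiagonal, ∑ P ∈ monicsOfDegree F x.1 with Irreducible P, x.1 * χ P ^ x.2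

theorem sum_filter_dvd_monicsOfDegree {F : Type*} [Field F] [Finite F] (χ : F[X] →* ℂ) {m : ℕ}
    {g : F[X]} (hg : g.Monic) [DecidablePred (g ∣ ·)] :
    ∑ h ∈ monicsOfDegree F m with g ∣ h, χ h =
      if g.natDegree ≤ m then χ g * sumMonics χ (m - g.natDegree) else 0 := by
  split_ifs with hm
  · rw [sumMonics, mul_sum]
    symm
    refine sum_bij (fun h _ => g * h) ?_ ?_ ?_ ?_
    · intro h hh
      rw [mem_monicsOfDegree] at hh
      rw [mem_filter, mem_monicsOfDegree]
      refine ⟨⟨hg.mul hh.1, ?_⟩, dvd_mul_right _ _⟩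
      rw [hg.natDegree_mul hh.1, hh.2]
      omega
    · intro a _ b _ h
      exact mul_left_cancel₀ hg.ne_zero h
    · intro h hh
      rw [mem_filter, mem_monicsOfDegree] at hh
      obtain ⟨⟨h1, h2⟩, r, rfl⟩ := hh
      have hr := hg.of_mul_monic_left h1
      refine ⟨r, ?_, rfl⟩
      rw [mem_monicsOfDegree]
      rw [hg.natDegree_mul hr] at h2
      exact ⟨hr, by omega⟩
    · intro h _
      rw [map_mul]
  · refine sum_eq_zero fun h hh => ?_
    rw [mem_filter, mem_monicsOfDegree] at hh
    exact absurd (natDegree_le_of_dvd hh.2 hh.1.1.ne_zero) (by omega)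

theorem natDegree_eq_sum_irreducible_pow_dvd {F : Type*} [Field F] [Finite F] {m : ℕ} {h : F[X]}
    (hh : h ∈ monicsOfDegree F m) [DecidablePred (Irreducible : F[X] → Prop)]
    [DecidableRel ((· ∣ ·) : F[X] → F[X] → Prop)] :
    m = ∑ d ∈ Icc 1 m, ∑ P ∈ monicsOfDegree F d with Irreducible P,
      ∑ e ∈ Icc 1 m, if P ^ e ∣ h then d else 0 := by
  classical
  obtain ⟨hm, hdeg⟩ := mem_monicsOfDegree.1 hh
  have hcount : ∀ d ∈ Icc 1 m, ∀ P ∈ (monicsOfDegree F d).filter Irreducible,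
      ∑ e ∈ Icc 1 m, (if P ^ e ∣ h then d else 0) =
        (UniqueFactorizationMonoid.normalizedFactors h).count P * P.natDegree := by
    intro d hd P hP
    rw [mem_filter, mem_monicsOfDegree] at hP
    obtain ⟨⟨hPm, rfl⟩, hPi⟩ := hP
    rw [← sum_filter, sum_const, smul_eq_mul]
    congr 1
    have : (Icc 1 m).filter (fun e => P ^ e ∣ h) =
        Icc 1 ((UniqueFactorizationMonoid.normalizedFactors h).count P) := by
      ext e
      rw [mem_filter, mem_Icc, mem_Icc]
      have key : P ^ e ∣ h ↔ e ≤ (UniqueFactorizationMonoid.normalizedFactors h).count P := by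
        rw [← Nat.cast_le (α := ℕ∞), ← hPm.normalize_eq_self,
          ← UniqueFactorizationMonoid.emultiplicity_eq_count_normalizedFactors hPi hm.ne_zero,
          hPm.normalize_eq_self,
          pow_dvd_iff_le_emultiplicity]
      constructor
      · rintro ⟨⟨h1, -⟩, h2⟩
        exact ⟨h1, key.1 h2⟩
      · rintro ⟨h1, h2⟩
        refine ⟨⟨h1, ?_⟩, key.2 h2⟩
        have := natDegree_le_of_dvd (key.2 h2) hm.ne_zero
        rw [hPm.natDegree_pow, hdeg] at this
        exact (Nat.le_mul_of_pos_right _ hPi.natDegree_pos).trans this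
    rw [this, Nat.card_Icc, Nat.add_sub_cancel]
  rw [sum_congr rfl fun d hd => sum_congr rfl (hcount d hd)]
  have hprod : (UniqueFactorizationMonoid.normalizedFactors h).prod = h := by
    rw [UniqueFactorizationMonoid.prod_normalizedFactors_eq hm.ne_zero, hm.normalize_eq_self]
  have hmem : ∀ P ∈ UniqueFactorizationMonoid.normalizedFactors h,
      P.Monic ∧ Irreducible P ∧ P ∣ h := by
    intro P hP
    have h1 := UniqueFactorizationMonoid.irreducible_of_normalized_factor P hP
    refine ⟨?_, h1, UniqueFactorizationMonoid.dvd_of_mem_normalizedFactors hP⟩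
    rw [← UniqueFactorizationMonoid.normalize_normalized_factor P hP]
    exact monic_normalize h1.ne_zero
  have h1 : m = ((UniqueFactorizationMonoid.normalizedFactors h).map natDegree).sum := by
    rw [← natDegree_multiset_prod_of_monic _ fun P hP => (hmem P hP).1, hprod, hdeg]
  rw [sum_multiset_map_count] at h1
  conv_lhs => rw [h1]
  rw [← sum_biUnion]
  · refine sum_subset_zero_on_sdiff ?_ ?_ fun _ _ => rfl
    · intro P hP
      rw [Multiset.mem_toFinset] at hP
      obtain ⟨a, b, c⟩ := hmem P hP
      rw [mem_biUnion]
      refine ⟨P.natDegree, mem_Icc.2 ⟨b.natDegree_pos, ?_⟩, ?_⟩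
      · rw [← hdeg]
        exact natDegree_le_of_dvd c hm.ne_zero
      · rw [mem_filter, mem_monicsOfDegree]
        exact ⟨⟨a, rfl⟩, b⟩
    · intro P hP
      rw [mem_sdiff, Multiset.mem_toFinset] at hP
      rw [Multiset.count_eq_zero.2 hP.2, zero_mul]
  · intro a _ b _ hab
    rw [Function.onFun, disjoint_left]
    intro P hPa hPb
    rw [mem_filter, mem_monicsOfDegree] at hPa hPb
    exact hab (hPa.1.2.symm.trans hPb.1.2)

theorem natCast_mul_sumMonics {F : Type*} [Field F] [Finite F] (χ : F[X] →* ℂ) (m : ℕ) :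
    m * sumMonics χ m = ∑ x ∈ antidiagonal m, sumIrreducibles χ x.1 * sumMonics χ x.2 := by
  classical
  have h1 : m * sumMonics χ m = ∑ d ∈ Icc 1 m, ∑ e ∈ Icc 1 m,
      ∑ P ∈ monicsOfDegree F d with Irreducible P,
        if e * d ≤ m then d * χ P ^ e * sumMonics χ (m - e * d) else 0 := by
    have h2 : ∀ h ∈ monicsOfDegree F m, m * χ h = ∑ d ∈ Icc 1 m,
      ∑ P ∈ monicsOfDegree F d with Irreducible P, ∑ e ∈ Icc 1 m,
        if P ^ e ∣ h then d * χ h else 0 := by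
      intro h hh
      conv_lhs => rw [natDegree_eq_sum_irreducible_pow_dvd hh]
      push_cast
      simp only [sum_mul, ite_mul, zero_mul]
    rw [sumMonics, mul_sum, sum_congr rfl h2, sum_comm]
    refine sum_congr rfl fun d _ => ?_
    rw [sum_comm, sum_comm (s := Icc 1 m)]
    refine sum_congr rfl fun P hP => ?_
    rw [mem_filter, mem_monicsOfDegree] at hP
    obtain ⟨⟨hPm, rfl⟩, hPi⟩ := hP
    rw [sum_comm]
    refine sum_congr rfl fun e _ => ?_
    rw [← sum_filter, ← mul_sum, sum_filter_dvd_monicsOfDegree χ (hPm.pow e), hPm.natDegree_pow,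
      map_pow]
    split_ifs
    · ring
    · rw [mul_zero]
  rw [h1]
  simp only [sumIrreducibles, sum_mul]
  have h3 : ∀ d e : ℕ, (∑ P ∈ monicsOfDegree F d with Irreducible P,
      if e * d ≤ m then d * χ P ^ e * sumMonics χ (m - e * d) else 0) =
      if e * d ≤ m then ∑ P ∈ monicsOfDegree F d with Irreducible P,
        d * χ P ^ e * sumMonics χ (m - e * d) else 0 := by
    intro d e
    split_ifs <;> simp
  simp only [h3]
  rw [← sum_product', ← sum_filter]
  conv_rhs => rw [sum_sigma']
  refine sum_bij' (fun x _ => ⟨(x.2 * x.1, m - x.2 * x.1), x⟩) (fun y _ => y.2) ?_ ?_ ?_ ?_ ?_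
  · rintro ⟨d, e⟩ h
    simp only [mem_filter, mem_product, mem_Icc] at h
    rw [mem_sigma, HasAntidiagonal.mem_antidiagonal, Nat.mem_divisorsAntidiagonal]
    refine ⟨by simp only; omega, mul_comm _ _, ?_⟩
    simp only [ne_eq, mul_eq_zero]
    omega
  · rintro ⟨⟨a, b⟩, ⟨d, e⟩⟩ h
    simp only [mem_sigma, HasAntidiagonal.mem_antidiagonal, Nat.mem_divisorsAntidiagonal] at h
    obtain ⟨h1, rfl, h2⟩ := h
    obtain ⟨hd, he⟩ := mul_ne_zero_iff.1 h2
    have hd' := Nat.le_mul_of_pos_right d (Nat.pos_of_ne_zero he)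
    have he' := Nat.le_mul_of_pos_left e (Nat.pos_of_ne_zero hd)
    simp only [mem_filter, mem_product, mem_Icc, mul_comm e d]
    omega
  · intro _ _
    rfl
  · rintro ⟨⟨a, b⟩, ⟨d, e⟩⟩ h
    simp only [mem_sigma, HasAntidiagonal.mem_antidiagonal, Nat.mem_divisorsAntidiagonal] at h
    obtain ⟨rfl, rfl, h2⟩ := h
    simp [mul_comm e d]
  · rintro ⟨d, e⟩ _
    rfl

/-- The multiplicative function `h ↦ ∏ i, χ i (h (c i))` on polynomials. -/
noncomputable def evalMulChar {F ι : Type*} [Field F] [Fintype ι] (χ : ι → MulChar F ℂ)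
    (c : ι → F) : F[X] →* ℂ where
  toFun h := ∏ i, χ i (h.eval (c i))
  map_one' := by simp
  map_mul' g h := by simp [prod_mul_distrib]

theorem evalMulChar_apply {F ι : Type*} [Field F] [Fintype ι] (χ : ι → MulChar F ℂ) (c : ι → F)
    (h : F[X]) : evalMulChar χ c h = ∏ i, χ i (h.eval (c i)) :=
  rfl

theorem sumMonics_zero {F : Type*} [Field F] [Finite F] (χ : F[X] →* ℂ) : sumMonics χ 0 = 1 := by
  rw [sumMonics, monicsOfDegree_zero, sum_singleton, map_one]

theorem sumMonics_one {F : Type*} [Field F] [Fintype F] (χ : F[X] →* ℂ) :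
    sumMonics χ 1 = ∑ x, χ (X - C x) := by
  classical
  rw [sumMonics, monicsOfDegree_one, sum_image]
  intro x _ y _ h
  simpa using h

theorem sumMonics_evalMulChar_eq_zero {F ι : Type*} [Field F] [Finite F] [Fintype ι]
    {χ : ι → MulChar F ℂ} {c : ι → F} (hc : Function.Injective c) {i₀ : ι} (hi₀ : χ i₀ ≠ 1) {m : ℕ}
    (hm : Fintype.card ι ≤ m) : sumMonics (evalMulChar χ c) m = 0 := by
  classical
  obtain ⟨b, hb⟩ := MulChar.ne_one_iff.1 hi₀
  set ℓ := Lagrange.basis univ c i₀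
  have hℓ1 : ℓ.eval (c i₀) = 1 := Lagrange.eval_basis_self hc.injOn (mem_univ _)
  have hℓ0 : ∀ i, i ≠ i₀ → ℓ.eval (c i) = 0 := fun i hi =>
    Lagrange.eval_basis_of_ne hi.symm (mem_univ _)
  have hℓd : ℓ.degree < m := by
    rw [Lagrange.degree_basis hc.injOn (mem_univ _), card_univ]
    have : 0 < Fintype.card ι := Fintype.card_pos_iff.2 ⟨i₀⟩
    exact_mod_cast (by omega : Fintype.card ι - 1 < m)
  let T : F → F[X] → F[X] := fun u h => h + C ((u - 1) * h.eval (c i₀)) * ℓ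
  have hT : ∀ u, ∀ h ∈ monicsOfDegree F m, T u h ∈ monicsOfDegree F m := by
    intro u h hh
    rw [mem_monicsOfDegree] at hh ⊢
    have h1 : (C ((u - 1) * h.eval (c i₀)) * ℓ).degree < h.degree := by
      rw [degree_eq_natDegree hh.1.ne_zero, hh.2]
      exact (degree_mul_le _ _).trans_lt (lt_of_le_of_lt (add_le_of_nonpos_left degree_C_le) hℓd)
    exact ⟨hh.1.add_of_left h1, by rw [natDegree_add_eq_left_of_degree_lt h1, hh.2]⟩
  have hTT : ∀ u v h, u * v = 1 → T u (T v h) = h := by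
    intro u v h huv
    have h1 : (T v h).eval (c i₀) = v * h.eval (c i₀) := by
      simp only [T, eval_add, eval_mul, eval_C, hℓ1]
      ring
    calc T u (T v h) = h + C ((v - 1) * h.eval (c i₀)) * ℓ +
          C ((u - 1) * (v * h.eval (c i₀))) * ℓ := by simp only [← h1]; rfl
      _ = h + C ((u * v - 1) * h.eval (c i₀)) * ℓ := by
          rw [add_assoc, ← add_mul, ← C_add]
          ring_nf
      _ = h := by rw [huv]; simp
  refine eq_zero_of_mul_eq_self_left hb ?_
  rw [sumMonics, mul_sum]
  refine sum_bij' (fun h _ => T b h) (fun h _ => T (b⁻¹ : Fˣ) h) (fun h hh => hT _ h hh)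
    (fun h hh => hT _ h hh) (fun h _ => hTT _ _ _ b.inv_mul) (fun h _ => hTT _ _ _ b.mul_inv) ?_
  intro h _
  rw [evalMulChar_apply, evalMulChar_apply, ← mul_prod_erase univ _ (mem_univ i₀),
    ← mul_prod_erase univ _ (mem_univ i₀), ← mul_assoc, ← map_mul]
  congr 1
  · simp only [T, eval_add, eval_mul, eval_C, hℓ1]
    ring_nf
  · refine prod_congr rfl fun i hi => ?_
    simp [T, hℓ0 i (ne_of_mem_erase hi)]

theorem Algebra.norm_algebraMap_sub_eq {F K : Type*} [Field F] [Field K] [Algebra F K]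
    [FiniteDimensional F K] (c : F) (x : K) :
    ∃ e : ℕ, (minpoly F x).natDegree * e = Module.finrank F K ∧
      Algebra.norm F (algebraMap F K c - x) = (minpoly F x).eval c ^ e := by
  have hx : IsIntegral F x := Algebra.IsIntegral.isIntegral x
  let E := IntermediateField.adjoin F {x}
  refine ⟨Module.finrank E K, ?_, ?_⟩
  · rw [← IntermediateField.adjoin.finrank hx]
    exact Module.finrank_mul_finrank F E K
  · let pb := IntermediateField.adjoin.powerBasis hx
    have h1 : algebraMap F K c - x = algebraMap E K (algebraMap F E c - pb.gen) := by
      rw [map_sub, ← IsScalarTower.algebraMap_apply]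
      simp [pb]
    have h2 : Algebra.norm F (algebraMap F E c - pb.gen) = (minpoly F x).eval c := by
      rw [Algebra.norm_eq_matrix_det pb.basis, map_sub, AlgHom.commutes]
      have h3 : minpoly F pb.gen = minpoly F x := by
        simp only [pb, IntermediateField.adjoin.powerBasis_gen]
        exact IntermediateField.minpoly_gen F x
      rw [← h3, ← charpoly_leftMulMatrix, Matrix.eval_charpoly]
      rfl
    rw [h1, ← Algebra.norm_norm (S := E), Algebra.norm_algebraMap, map_pow, h2]

theorem sumIrreducibles_evalMulChar {F K ι : Type*} [Field F] [Finite F] [Field K] [Fintype K]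
    [Algebra F K] [Fintype ι] (χ : ι → MulChar F ℂ) (c : ι → F) :
    sumIrreducibles (evalMulChar χ c) (Module.finrank F K) =
      ∑ x : K, ∏ i, χ i (Algebra.norm F (algebraMap F K (c i) - x)) := by
  classical
  set k := Module.finrank F K
  have hk : k ≠ 0 := Module.finrank_pos.ne'
  have h1 : ∀ x : K, (⟨((minpoly F x).natDegree, k / (minpoly F x).natDegree), minpoly F x⟩ :
      (_ : ℕ × ℕ) × F[X]) ∈ k.divisorsAntidiagonal.sigma
        fun y => (monicsOfDegree F y.1).filter Irreducible := by
    intro x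
    have hx : IsIntegral F x := Algebra.IsIntegral.isIntegral x
    rw [mem_sigma, mem_filter, mem_monicsOfDegree, Nat.mem_divisorsAntidiagonal]
    exact ⟨⟨Nat.mul_div_cancel' (minpoly.degree_dvd hx), hk⟩,
      ⟨minpoly.monic hx, rfl⟩, minpoly.irreducible hx⟩
  rw [sumIrreducibles, sum_sigma', ← sum_fiberwise_of_maps_to (g := fun x : K =>
    (⟨((minpoly F x).natDegree, k / (minpoly F x).natDegree), minpoly F x⟩ :
      (_ : ℕ × ℕ) × F[X])) (fun x _ => h1 x)]
  refine sum_congr rfl ?_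
  rintro ⟨⟨d, e⟩, P⟩ h
  simp only [mem_sigma, mem_filter, mem_monicsOfDegree, Nat.mem_divisorsAntidiagonal] at h
  obtain ⟨⟨hde, -⟩, ⟨hPm, rfl⟩, hPi⟩ := h
  have hfib : ∀ x : K, ((⟨((minpoly F x).natDegree, k / (minpoly F x).natDegree), minpoly F x⟩ :
      (_ : ℕ × ℕ) × F[X]) = ⟨(P.natDegree, e), P⟩) ↔ x ∈ P.rootSet K := by
    intro x
    rw [mem_rootSet]
    constructor
    · intro h
      have h2 : minpoly F x = P := by simpa using congrArg Sigma.snd h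
      rw [← h2]
      exact ⟨minpoly.ne_zero (Algebra.IsIntegral.isIntegral x), minpoly.aeval F x⟩
    · rintro ⟨-, h2⟩
      rw [← minpoly.eq_of_irreducible_of_monic hPi h2 hPm, ← hde,
        Nat.mul_div_cancel_left _ hPi.natDegree_pos]
  have hval : ∀ x ∈ P.rootSet K,
      ∏ i, χ i (Algebra.norm F (algebraMap F K (c i) - x)) = evalMulChar χ c P ^ e := by
    intro x hx
    rw [mem_rootSet] at hx
    have h2 := minpoly.eq_of_irreducible_of_monic hPi hx.2 hPm
    rw [evalMulChar_apply, ← prod_pow]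
    refine prod_congr rfl fun i _ => ?_
    obtain ⟨e', he', h3⟩ := Algebra.norm_algebraMap_sub_eq (c i) x
    rw [← h2] at he' h3
    rw [h3, map_pow, Nat.mul_left_cancel hPi.natDegree_pos (he'.trans hde.symm)]
  have hcard : Fintype.card (P.rootSet K) = P.natDegree := by
    refine card_rootSet_eq_natDegree (PerfectField.separable_of_irreducible hPi) ?_
    have h2 : P ∣ X ^ Nat.card K - X := by
      rw [Module.natCard_eq_pow_finrank (K := F)]
      exact hPi.natDegree_dvd_iff_dvd_X_pow_card_pow_sub_X.1 ⟨e, hde.symm⟩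
    refine (Polynomial.splits_X_pow_nat_card_sub_X (K := K)).of_dvd
      (FiniteField.X_pow_card_sub_X_ne_zero K Finite.one_lt_card) ?_
    simpa using map_dvd (mapRingHom (algebraMap F K)) h2
  simp only [hfib]
  rw [sum_congr rfl fun x hx => hval x (mem_filter.1 hx).2, sum_const, nsmul_eq_mul, ← hcard,
    ← Fintype.card_subtype]

theorem exists_norm_mul_derivative_eval_le {L : ℂ[X]} {S : ℕ → ℂ}
    (hS : ∀ m, m * L.coeff m = ∑ x ∈ antidiagonal m, S x.1 * L.coeff x.2) {B r : ℝ}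
    (hr : 0 < r) (hB : ∀ k, ‖S k‖ ≤ B * r ^ k) {ρ : ℝ} (hρ : ρ * r < 1) :
    ∃ M : ℝ, ∀ t : ℂ, ‖t‖ ≤ ρ → ‖t * L.derivative.eval t‖ ≤ M * ‖L.eval t‖ := by
  have hB0 : 0 ≤ B := by simpa using (norm_nonneg _).trans (hB 0)
  refine ⟨∑' k, B * (ρ * r) ^ k, fun t ht => ?_⟩
  have hρ0 : 0 ≤ ρ := (norm_nonneg t).trans ht
  have hg : Summable fun k : ℕ => B * (ρ * r) ^ k :=
    (summable_geometric_of_lt_one (by positivity) hρ).mul_left B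
  have hle : ∀ k, ‖S k * t ^ k‖ ≤ B * (ρ * r) ^ k := by
    intro k
    rw [norm_mul, norm_pow, mul_comm ρ, mul_pow, ← mul_assoc]
    gcongr
    exact hB k
  have hsum : Summable fun k => ‖S k * t ^ k‖ := hg.of_nonneg_of_le (fun _ => norm_nonneg _) hle
  have hL : HasSum (fun m => L.coeff m * t ^ m) (L.eval t) := by
    rw [eval_eq_sum_range]
    refine hasSum_sum_of_ne_finset_zero fun m hm => ?_
    rw [coeff_eq_zero_of_natDegree_lt (by simpa [Nat.lt_succ_iff] using hm), zero_mul]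
  have hL' : HasSum (fun m => m * L.coeff m * t ^ m) (t * L.derivative.eval t) := by
    have h1 : t * L.derivative.eval t =
        ∑ m ∈ range (L.natDegree + 1), m * L.coeff m * t ^ m := by
      rw [derivative_eval, sum_over_range _ (by simp), mul_sum]
      refine sum_congr rfl fun m _ => ?_
      rcases m with _ | m
      · simp
      · rw [Nat.add_sub_cancel, pow_succ]
        ring
    rw [h1]
    refine hasSum_sum_of_ne_finset_zero fun m hm => ?_
    rw [coeff_eq_zero_of_natDegree_lt (by simpa [Nat.lt_succ_iff] using hm), mul_zero, zero_mul]
  have hLn : Summable fun m => ‖L.coeff m * t ^ m‖ := hL.summable.norm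
  have h1 := tsum_mul_tsum_eq_tsum_sum_antidiagonal_of_summable_norm hsum hLn
  have h2 : ∀ m, ∑ x ∈ antidiagonal m, S x.1 * t ^ x.1 * (L.coeff x.2 * t ^ x.2) =
      m * L.coeff m * t ^ m := by
    intro m
    rw [hS, sum_mul]
    refine sum_congr rfl fun x hx => ?_
    rw [← HasAntidiagonal.mem_antidiagonal.1 hx, pow_add]
    ring
  rw [tsum_congr h2, hL'.tsum_eq, hL.tsum_eq] at h1
  rw [← h1, norm_mul]
  gcongr
  exact (norm_tsum_le_tsum_norm hsum).trans (hsum.tsum_le_tsum hle hg)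

theorem one_le_norm_root_mul {L : ℂ[X]} (hL0 : L.coeff 0 ≠ 0) {S : ℕ → ℂ}
    (hS : ∀ m, m * L.coeff m = ∑ x ∈ antidiagonal m, S x.1 * L.coeff x.2) {B r : ℝ}
    (hr : 0 < r) (hB : ∀ k, ‖S k‖ ≤ B * r ^ k) {z : ℂ} (hz : L.eval z = 0) : 1 ≤ ‖z‖ * r := by
  by_contra! hlt
  have hL : L ≠ 0 := by rintro rfl; simp at hL0
  have hz0 : z ≠ 0 := by
    rintro rfl
    rw [← coeff_zero_eq_eval_zero] at hz
    exact hL0 hz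
  obtain ⟨ρ, hρ1, hρ2⟩ : ∃ ρ, ‖z‖ < ρ ∧ ρ * r < 1 := by
    obtain ⟨ρ, h1, h2⟩ := exists_between ((lt_div_iff₀ hr).2 hlt)
    exact ⟨ρ, h1, (lt_div_iff₀ hr).1 h2⟩
  obtain ⟨M, hM⟩ := exists_norm_mul_derivative_eval_le hS hr hB hρ2
  obtain ⟨g, hg, hgz⟩ := exists_eq_pow_rootMultiplicity_mul_and_not_dvd L hL z
  have hm := (rootMultiplicity_pos hL).2 hz
  obtain ⟨m, hm⟩ := Nat.exists_eq_add_one.2 hm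
  rw [hm] at hg
  have hgz' : g.eval z ≠ 0 := fun h => hgz (dvd_iff_isRoot.2 h)
  set H : ℂ[X] := X * (C ((m : ℂ) + 1) * g + (X - C z) * derivative g) with hH
  have hd : X * derivative L = (X - C z) ^ m * H := by
    rw [hg, derivative_mul, derivative_X_sub_C_pow, Nat.add_sub_cancel]
    rw [hH]
    push_cast
    ring
  have hev : ∀ᶠ t in nhdsWithin z {z}ᶜ, ‖H.eval t‖ ≤ M * (‖t - z‖ * ‖g.eval t‖) := by
    have h1 : ∀ᶠ t in nhdsWithin z {z}ᶜ, ‖t‖ < ρ :=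
      eventually_nhdsWithin_of_eventually_nhds
        (continuous_norm.continuousAt.eventually_lt continuousAt_const hρ1)
    filter_upwards [h1, self_mem_nhdsWithin] with t ht htz
    have h2 : 0 < ‖t - z‖ ^ m := by
      have : t - z ≠ 0 := sub_ne_zero.2 htz
      positivity
    have h3 := hM t ht.le
    have h4 : t * L.derivative.eval t = (t - z) ^ m * H.eval t := by
      simpa using congrArg (eval t) hd
    have h5 : L.eval t = (t - z) ^ (m + 1) * g.eval t := by
      conv_lhs => rw [hg]
      simp
    rw [h4, h5, norm_mul, norm_mul, norm_pow, norm_pow, pow_succ] at h3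
    refine le_of_mul_le_mul_left (h3.trans_eq ?_) h2
    ring
  have h1 : Filter.Tendsto (fun t => ‖H.eval t‖) (nhdsWithin z {z}ᶜ) (nhds ‖H.eval z‖) :=
    (H.continuous.norm.tendsto z).mono_left nhdsWithin_le_nhds
  have h2 : Filter.Tendsto (fun t => M * (‖t - z‖ * ‖g.eval t‖)) (nhdsWithin z {z}ᶜ)
      (nhds (M * (‖z - z‖ * ‖g.eval z‖))) := by
    have : Continuous fun t => M * (‖t - z‖ * ‖g.eval t‖) := by fun_prop
    exact (this.tendsto z).mono_left nhdsWithin_le_nhds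
  have h3 := le_of_tendsto_of_tendsto h1 h2 hev
  rw [sub_self, norm_zero, zero_mul, mul_zero, norm_le_zero_iff] at h3
  have h4 : H.eval z = z * (((m : ℂ) + 1) * g.eval z) := by simp [H]
  rw [h4] at h3
  refine mul_ne_zero hz0 (mul_ne_zero ?_ hgz') h3
  exact Nat.cast_add_one_ne_zero m

theorem norm_coeff_one_le {L : ℂ[X]} (hL0 : L.coeff 0 = 1) {S : ℕ → ℂ}
    (hS : ∀ m, m * L.coeff m = ∑ x ∈ antidiagonal m, S x.1 * L.coeff x.2) {B r : ℝ}
    (hr : 0 < r) (hB : ∀ k, ‖S k‖ ≤ B * r ^ k) : ‖L.coeff 1‖ ≤ L.natDegree * r := by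
  have hL : L ≠ 0 := by rintro rfl; simp at hL0
  have h0 : L.eval 0 = 1 := by rw [← coeff_zero_eq_eval_zero, hL0]
  have h1 := (IsAlgClosed.splits L).eval_derivative_div_eval_of_ne_zero (x := 0)
    (by rw [h0]; exact one_ne_zero)
  have h2 : L.derivative.eval 0 = L.coeff 1 := by
    rw [← coeff_zero_eq_eval_zero, coeff_derivative]
    simp
  rw [h0, h2, div_one] at h1
  rw [h1]
  have h3 : ∀ z ∈ L.roots, ‖1 / (0 - z)‖ ≤ r := by
    intro z hz
    have h4 := one_le_norm_root_mul (by rw [hL0]; exact one_ne_zero) hS hr hB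
      ((mem_roots hL).1 hz)
    have h5 : 0 < ‖z‖ := by
      by_contra! h
      nlinarith
    rw [zero_sub, norm_div, norm_neg, norm_one, div_le_iff₀ h5, mul_comm]
    exact h4
  calc _ ≤ ((L.roots.map fun z => 1 / (0 - z)).map norm).sum := norm_multiset_sum_le _
    _ ≤ (L.roots.map fun _ => r).sum := by
        rw [Multiset.map_map]
        exact Multiset.sum_map_le_sum_map _ _ h3
    _ = L.roots.card * r := by simp
    _ ≤ _ := by
        gcongr
        exact card_roots' L
/-- The multiplicative character `χ ∘ N` of an extension field. -/
noncomputable def MulChar.compNorm {F : Type*} [Field F] (K : Type*) [Field K] [Algebra F K]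
    [FiniteDimensional F K] (χ : MulChar F ℂ) : MulChar K ℂ where
  toMonoidHom := (χ : F →* ℂ).comp (Algebra.norm F)
  map_nonunit' x hx := by
    have : x = 0 := by simpa using hx
    simp [this]

theorem MulChar.compNorm_apply {F : Type*} [Field F] (K : Type*) [Field K] [Algebra F K]
    [FiniteDimensional F K] (χ : MulChar F ℂ) (x : K) :
    χ.compNorm K x = χ (Algebra.norm F x) :=
  rfl

theorem MulChar.compNorm_pow_eq_one {F : Type*} [Field F] (K : Type*) [Field K] [Algebra F K]
    [FiniteDimensional F K] {χ : MulChar F ℂ} {d : ℕ} (h : χ ^ d = 1) :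
    χ.compNorm K ^ d = 1 := by
  ext x
  have hx : Algebra.norm F (x : K) ≠ 0 := Algebra.norm_ne_zero_iff.2 x.ne_zero
  rw [MulChar.pow_apply_coe, compNorm_apply, MulChar.one_apply_coe, ← Units.val_mk0 hx,
    ← MulChar.pow_apply_coe, h, MulChar.one_apply_coe]

theorem MulChar.compNorm_ne_one {F : Type*} [Field F] (K : Type*) [Field K] [Finite K]
    [Algebra F K] [FiniteDimensional F K] {χ : MulChar F ℂ} (h : χ ≠ 1) : χ.compNorm K ≠ 1 := by
  obtain ⟨b, hb⟩ := MulChar.ne_one_iff.1 h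
  obtain ⟨x, hx⟩ := FiniteField.norm_surjective F K b
  have hx0 : x ≠ 0 := by
    rintro rfl
    rw [Algebra.norm_zero] at hx
    exact b.ne_zero hx.symm
  refine MulChar.ne_one_iff.2 ⟨Units.mk0 x hx0, ?_⟩
  rwa [compNorm_apply, Units.val_mk0, hx]

theorem MulChar.exists_eq_pow {F ι : Type*} [Field F] [Finite F] [Fintype ι]
    {χ : ι → MulChar F ℂ} {i₀ : ι} (hi₀ : χ i₀ ≠ 1) :
    ∃ (ω : MulChar F ℂ) (d : ℕ) (a : ι → ℕ), 0 < d ∧ d ∣ Nat.card F - 1 ∧ ω ^ d = 1 ∧ ω ≠ 1 ∧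
      (∀ i, a i ≠ 0) ∧ (∀ i, χ i = ω ^ a i) ∧ ∀ e, (∀ i, d ∣ e * a i) → d ∣ e := by
  classical
  have := Fintype.ofFinite F
  obtain ⟨γ, hγ⟩ := IsCyclic.exists_generator (α := Fˣ)
  set N := Fintype.card F - 1 with hN
  have hN0 : N ≠ 0 := Nat.sub_ne_zero_of_lt Fintype.one_lt_card
  have : NeZero N := ⟨hN0⟩
  obtain ⟨θ, hθ⟩ := MulChar.exists_mulChar_orderOf F (dvd_refl N)
    (Complex.isPrimitiveRoot_exp N hN0)
  have hθN : θ ^ N = 1 := by rw [← hθ, pow_orderOf_eq_one]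
  have hprim : IsPrimitiveRoot (θ γ) N := by
    refine IsPrimitiveRoot.mk_of_lt _ (Nat.pos_of_ne_zero hN0) ?_ ?_
    · rw [← MulChar.pow_apply_coe, hθN, MulChar.one_apply_coe]
    · intro l hl hlN h
      rw [← MulChar.pow_apply_coe, ← MulChar.one_apply_coe (R' := ℂ) γ,
        ← MulChar.eq_iff hγ] at h
      exact absurd (Nat.le_of_dvd hl (hθ ▸ orderOf_dvd_of_pow_eq_one h)) (by omega)
  have hk : ∀ i, ∃ k, χ i = θ ^ (k + N) := by
    intro i
    have h1 : (χ i γ) ^ N = 1 := by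
      rw [← map_pow, FiniteField.pow_card_sub_one_eq_one _ γ.ne_zero, map_one]
    obtain ⟨k, -, hk⟩ := hprim.eq_pow_of_pow_eq_one h1
    refine ⟨k, (MulChar.eq_iff hγ _ _).2 ?_⟩
    rw [pow_add, hθN, mul_one, MulChar.pow_apply_coe, hk]
  choose k hk using hk
  set g := Nat.gcd N (univ.gcd fun i => k i + N) with hg
  have hg0 : 0 < g := Nat.gcd_pos_of_pos_left _ (Nat.pos_of_ne_zero hN0)
  obtain ⟨d, hd⟩ : g ∣ N := Nat.gcd_dvd_left _ _
  have hgi : ∀ i, g ∣ k i + N := fun i =>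
    (Nat.gcd_dvd_right _ _).trans (Finset.gcd_dvd (mem_univ i))
  choose a ha using hgi
  have hχ : ∀ i, χ i = (θ ^ g) ^ a i := by
    intro i
    rw [hk, ha, pow_mul]
  refine ⟨θ ^ g, d, a, ?_, ?_, ?_, ?_, ?_, hχ, ?_⟩
  · exact Nat.pos_of_ne_zero fun h => hN0 (by rw [hd, h, mul_zero])
  · rw [Nat.card_eq_fintype_card, ← hN, hd]
    exact dvd_mul_left _ _
  · rw [← pow_mul, ← hd, hθN]
  · intro h
    exact hi₀ (by rw [hχ, h, one_pow])
  · intro i h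
    have := ha i
    rw [h, mul_zero] at this
    omega
  · intro e he
    have h1 : N ∣ e * g := by
      rw [hg, ← Nat.gcd_mul_left]
      refine Nat.dvd_gcd (dvd_mul_left _ _) ?_
      have h2 := Finset.gcd_mul_left (s := univ) (f := fun i => k i + N) (a := e)
      rw [normalize_eq] at h2
      rw [← h2]
      refine Finset.dvd_gcd fun i _ => ?_
      rw [ha i, mul_left_comm, hd]
      exact mul_dvd_mul_left g (he i)
    rw [hd, mul_comm] at h1
    exact Nat.dvd_of_mul_dvd_mul_right hg0 h1

theorem rootMultiplicity_prod_X_sub_C_pow {K ι : Type*} [Field K] [Fintype ι] {c : ι → K}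
    (hc : Function.Injective c) (a : ι → ℕ) (i : ι) :
    (∏ j, (X - C (c j)) ^ a j).rootMultiplicity (c i) = a i := by
  classical
  rw [← prod_erase_mul univ _ (mem_univ i), rootMultiplicity_mul_X_sub_C_pow,
    rootMultiplicity_eq_zero, zero_add]
  · rw [IsRoot, eval_prod, prod_eq_zero_iff]
    rintro ⟨j, hj, h⟩
    rw [eval_pow, eval_sub, eval_X, eval_C] at h
    exact ne_of_mem_erase hj (hc (sub_eq_zero.1 (eq_zero_of_pow_eq_zero h))).symm
  · exact prod_ne_zero_iff.2 fun j _ => pow_ne_zero _ (X_sub_C_ne_zero _)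

theorem exists_norm_sumIrreducibles_le {F ι : Type*} [Field F] [Finite F] [Fintype ι]
    {χ : ι → MulChar F ℂ} {c : ι → F} (hc : Function.Injective c) (hc0 : ∀ i, c i ≠ 0)
    {i₀ : ι} (hi₀ : χ i₀ ≠ 1) :
    ∃ B : ℝ, ∀ k, ‖sumIrreducibles (evalMulChar χ c) k‖ ≤ B * √(Nat.card F) ^ k := by
  obtain ⟨ω, d, a, hd, hdF, hω, hω1, ha0, ha, hgcd⟩ := MulChar.exists_eq_pow hi₀
  set D := ∑ i, a i with hD
  refine ⟨((d * D + 4 * (d * (d * D + 2) + D + 1) +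
      d * (d * (d * D + 2) + (d * D + 2) * (d * D + 1) + 1) + D : ℕ) : ℝ), fun k => ?_⟩
  rcases Nat.eq_zero_or_pos k with rfl | hk
  · simp only [sumIrreducibles, Nat.divisorsAntidiagonal_zero, sum_empty, norm_zero]
    positivity
  obtain ⟨p, hp⟩ := CharP.exists F
  have : Fact p.Prime := ⟨CharP.char_is_prime F p⟩
  have : NeZero k := ⟨hk.ne'⟩
  let K := FiniteField.Extension F p k
  have := Fintype.ofFinite K
  have hcard : Fintype.card K = Nat.card F ^ k := by
    rw [← Nat.card_eq_fintype_card]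
    exact FiniteField.natCard_extension F p k
  let φ := algebraMap F K
  set f : K[X] := ∏ i, (X - C (φ (c i))) ^ a i with hf
  have hfD : f.natDegree = D := by
    rw [hf, natDegree_prod_of_monic _ _ fun i _ => (monic_X_sub_C _).pow _]
    simp [hD]
  have hf0 : f.eval 0 ≠ 0 := by
    rw [hf, eval_prod]
    refine prod_ne_zero_iff.2 fun i _ => ?_
    simp [ha0, hc0]
  have hsum : ‖sumIrreducibles (evalMulChar χ c) k‖ ≤ ‖∑ x, ω.compNorm K (f.eval x)‖ := by
    have h1 : ∀ x : K, ∏ i, χ i (Algebra.norm F (φ (c i) - x)) =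
        ω.compNorm K ((-1) ^ D) * ω.compNorm K (f.eval x) := by
      intro x
      rw [← map_mul]
      have h2 : (-1) ^ D * f.eval x = ∏ i, (φ (c i) - x) ^ a i := by
        rw [hf, hD, ← prod_pow_eq_pow_sum, eval_prod, ← prod_mul_distrib]
        refine prod_congr rfl fun i _ => ?_
        rw [eval_pow, eval_sub, eval_X, eval_C, ← mul_pow]
        congr 1
        ring
      rw [h2, map_prod]
      refine prod_congr rfl fun i _ => ?_
      rw [ha, MulChar.pow_apply' _ (ha0 i), map_pow, MulChar.compNorm_apply]
    have h2 := sumIrreducibles_evalMulChar (K := K) χ c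
    rw [show Module.finrank F K = k from FiniteField.finrank_extension F p k] at h2
    rw [h2, sum_congr rfl fun x _ => h1 x, ← mul_sum, norm_mul]
    exact mul_le_of_le_one_left (norm_nonneg _) (MulChar.norm_apply_le_one _ _)
  refine hsum.trans ?_
  obtain ⟨C₀, hC₀, h⟩ := norm_sum_mulChar_eval_le hf0 hd
    (hdF.trans (by rw [hcard]; exact Nat.sub_one_dvd_pow_sub_one _ _))
    (fun e he => hgcd e fun i => by
      have := he (φ (c i))
      rwa [hf, rootMultiplicity_prod_X_sub_C_pow (c := fun i => φ (c i))
        (φ.injective.comp hc)] at this)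
    (MulChar.compNorm_pow_eq_one K hω) (MulChar.compNorm_ne_one K hω1)
  rw [hC₀, hfD, hcard] at h
  refine h.trans_eq ?_
  congr 1
  push_cast
  rw [Real.sqrt_eq_iff_mul_self_eq (by positivity) (by positivity), ← mul_pow,
    Real.mul_self_sqrt (by positivity)]

theorem norm_sum_prod_mulChar_sub_le {F ι : Type*} [Field F] [Fintype F] [Fintype ι]
    {χ : ι → MulChar F ℂ} {c : ι → F} (hc : Function.Injective c) (hc0 : ∀ i, c i ≠ 0)
    {i₀ : ι} (hi₀ : χ i₀ ≠ 1) :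
    ‖∑ x, ∏ i, χ i (c i - x)‖ ≤ (Fintype.card ι - 1 : ℕ) * √(Fintype.card F) := by
  set ψ := evalMulChar χ c with hψ
  have hn : 0 < Fintype.card ι := Fintype.card_pos_iff.2 ⟨i₀⟩
  set L : ℂ[X] := ∑ m ∈ range (Fintype.card ι), C (sumMonics ψ m) * X ^ m with hL
  have hcoeff : ∀ m, L.coeff m = sumMonics ψ m := by
    intro m
    simp only [hL, finsetSum_coeff, coeff_C_mul, coeff_X_pow, mul_ite, mul_one, mul_zero,
      sum_ite_eq, mem_range]
    split_ifs with h
    · rfl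
    · exact (sumMonics_evalMulChar_eq_zero hc hi₀ (not_lt.1 h)).symm
  have hdeg : L.natDegree ≤ Fintype.card ι - 1 := by
    rw [natDegree_le_iff_coeff_eq_zero]
    intro m hm
    rw [hcoeff]
    exact sumMonics_evalMulChar_eq_zero hc hi₀ (by omega)
  obtain ⟨B, hB⟩ := exists_norm_sumIrreducibles_le hc hc0 hi₀
  have hq : 0 < √(Nat.card F : ℝ) := Real.sqrt_pos.2 (by exact_mod_cast Nat.card_pos)
  have h1 := norm_coeff_one_le (L := L) (by rw [hcoeff, sumMonics_zero])
    (S := sumIrreducibles ψ) (fun m => by simpa only [hcoeff] using natCast_mul_sumMonics ψ m)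
    hq hB
  rw [hcoeff, sumMonics_one, Nat.card_eq_fintype_card] at h1
  simp only [hψ, evalMulChar_apply, eval_sub, eval_X, eval_C] at h1
  refine h1.trans ?_
  gcongr

theorem norm_sum_prod_mulChar_add_le {F ι : Type*} [Field F] [Fintype F] [Fintype ι]
    (hι : Fintype.card ι < Fintype.card F) {χ : ι → MulChar F ℂ} {c : ι → F}
    (hc : Function.Injective c) {i₀ : ι} (hi₀ : χ i₀ ≠ 1) :
    ‖∑ x, ∏ i, χ i (x + c i)‖ ≤ (Fintype.card ι - 1 : ℕ) * √(Fintype.card F) := by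
  obtain ⟨s, hs⟩ : ∃ s, ∀ i, s ≠ -c i := by
    by_contra! h
    exact absurd (Fintype.card_le_of_surjective (fun i => -c i) fun s => (h s).imp fun _ => Eq.symm)
      (not_le.2 hι)
  have h1 := norm_sum_prod_mulChar_sub_le (c := fun i => s + c i)
    (fun i j h => hc (add_left_cancel h)) (fun i h => hs i (eq_neg_of_add_eq_zero_left h)) hi₀
  rw [← Equiv.sum_comp (Equiv.subLeft s)]
  simpa only [Equiv.subLeft_apply, sub_add_eq_add_sub] using h1

theorem isPrimitiveElem_of_mulChar_ne_one {F : Type*} [Field F] [Fintype F]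
    {ψ : ℕ → MulChar F ℂ} (hψ : ∀ l ∈ (Fintype.card F - 1).primeFactors, ψ l ^ l = 1) {y : F}
    (hy : y ≠ 0) (h : ∀ l ∈ (Fintype.card F - 1).primeFactors, ψ l y ≠ 1) : IsPrimitiveElem y := by
  classical
  have hN : Fintype.card F - 1 ≠ 0 := Nat.sub_ne_zero_of_lt Fintype.one_lt_card
  have ho : orderOf (Units.mk0 y hy) = Fintype.card F - 1 := by
    refine orderOf_eq_of_pow_and_pow_div_prime (Nat.pos_of_ne_zero hN) ?_ fun l hl hlN h1 => ?_
    · ext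
      simpa using FiniteField.pow_card_sub_one_eq_one y hy
    · have hmem : l ∈ (Fintype.card F - 1).primeFactors := Nat.mem_primeFactors.2 ⟨hl, hlN, hN⟩
      refine h l hmem ?_
      have h2 := MulChar.apply_eq_of_pow_eq (d := l) (E := (Fintype.card F - 1) / l)
        (by rw [Nat.mul_div_cancel' hlN]; omega) (hψ l hmem) (h1.trans (one_pow _).symm)
      simpa using h2
  intro x hx
  have h1 : Units.mk0 x hx ∈ Subgroup.zpowers (Units.mk0 y hy) := by
    have : Subgroup.zpowers (Units.mk0 y hy) = ⊤ := by
      refine Subgroup.eq_top_of_card_eq _ ?_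
      rw [Nat.card_zpowers, ho, Nat.card_eq_fintype_card, Fintype.card_units]
    rw [this]
    exact Subgroup.mem_top _
  obtain ⟨k, hk⟩ := mem_powers_iff_mem_zpowers.2 h1
  exact ⟨k, by simpa using congrArg Units.val hk⟩

theorem MulChar.apply_neg_one_eq_neg_one {F : Type*} [Field F] [Fintype F]
    (hF : Fintype.card F % 4 = 3) {ψ : MulChar F ℂ} (hψ : ψ ^ 2 = 1) (hψ1 : ψ ≠ 1) :
    ψ (-1) = -1 := by
  obtain ⟨b, hb⟩ := MulChar.ne_one_iff.1 hψ1
  obtain ⟨E, hE, hodd⟩ : ∃ E, 2 * E + 1 = Fintype.card F ∧ Odd E :=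
    ⟨Fintype.card F / 2, by omega, Nat.odd_iff.2 (by omega)⟩
  have h1 : (b : F) ^ E * (b : F) ^ E = 1 := by
    rw [← pow_add, ← FiniteField.pow_card_sub_one_eq_one _ b.ne_zero]
    congr 1
    omega
  have h2 : ψ b = ψ ((-1 : Fˣ) : F) := by
    refine MulChar.apply_eq_of_pow_eq hE hψ ?_
    rcases mul_self_eq_one_iff.1 h1 with h | h
    · refine absurd ?_ hb
      have := MulChar.apply_eq_of_pow_eq (y := b) (z := 1) hE hψ (by ext; simpa using h)
      simpa using this
    · ext
      simpa [hodd.neg_one_pow] using h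
  have h3 : ψ (-1) * ψ (-1) = 1 := by rw [← map_mul]; simp
  rcases mul_self_eq_one_iff.1 h3 with h | h
  · exact absurd (h2.trans (by simpa using h)) hb
  · exact h

theorem MulChar.apply_neg_one_eq_one {F : Type*} [Field F] {ψ : MulChar F ℂ} {l : ℕ} (hl : Odd l)
    (hψ : ψ ^ l = 1) : ψ (-1) = 1 := by
  have h1 : ψ (-1) ^ l = 1 := by
    rw [← MulChar.pow_apply' _ hl.pos.ne', hψ]
    exact MulChar.one_apply_coe (-1)
  have h3 : ψ (-1) * ψ (-1) = 1 := by rw [← map_mul]; simp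
  rcases mul_self_eq_one_iff.1 h3 with h | h
  · exact h
  · rw [h, hl.neg_one_pow] at h1
    norm_num at h1

theorem MulChar.prod_apply {F ι : Type*} [Field F] {s : Finset ι} (hs : s.Nonempty)
    (χ : ι → MulChar F ℂ) (x : F) : (∏ i ∈ s, χ i) x = ∏ i ∈ s, χ i x := by
  induction hs using Finset.Nonempty.cons_induction with
  | singleton a => simp
  | cons a s ha hs ih => rw [prod_cons, prod_cons, MulChar.mul_apply, ih]

/-- The absolute weight of the `t`-th power of a character of order `l`, except that the
quadratic character gets the weight `s`. -/
noncomputable def powWeight (s : ℝ) (l t : ℕ) : ℝ :=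
  if t = 0 then 1 else if l = 2 then s else ((l : ℝ) - 1)⁻¹

/-- The sign of the nontrivial powers of a character of order `l ≠ 2`. -/
noncomputable def powSign (l t : ℕ) : ℝ :=
  if t = 0 ∨ l = 2 then 1 else -1

theorem sum_powWeight_one {l : ℕ} (hl : l.Prime) : ∑ t ∈ range l, powWeight 1 l t = 2 := by
  obtain ⟨m, rfl⟩ := Nat.exists_eq_add_one.2 hl.pos
  rw [sum_range_succ']
  by_cases h : m + 1 = 2
  · obtain rfl : m = 1 := by omega
    norm_num [powWeight]
  · have hm : (m : ℝ) ≠ 0 := Nat.cast_ne_zero.2 (by have := hl.two_le; omega)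
    simp [powWeight, h, hm]
    norm_num

theorem sum_powWeight_neg_one : ∑ t ∈ range 2, powWeight (-1) 2 t = 0 := by
  simp [sum_range_succ, powWeight]

theorem apply_of_sum_powWeight_ne_zero {F : Type*} [Field F] {l : ℕ} (hl : l.Prime)
    {ψ : MulChar F ℂ} (hψ : ψ ^ l = 1) {s : ℝ} (hs : s = 1 ∨ s = -1) {y : F}
    (h : ∑ t ∈ range l, (powSign l t * powWeight s l t : ℝ) * (ψ ^ t) y ≠ 0) :
    y ≠ 0 ∧ (l ≠ 2 → ψ y ≠ 1) ∧ (l = 2 → ψ y = s) := by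
  have hy : y ≠ 0 := by
    rintro rfl
    exact h (sum_eq_zero fun t _ => by rw [MulChar.map_zero, mul_zero])
  have hpow : ∀ t, (ψ ^ t) y = ψ y ^ t := fun t => MulChar.pow_apply_coe ψ t (Units.mk0 y hy)
  simp only [hpow] at h
  have hyl : ψ y ^ l = 1 := by
    rw [← hpow, hψ]
    exact MulChar.one_apply_coe (Units.mk0 y hy)
  refine ⟨hy, fun hl2 h1 => h ?_, ?_⟩
  · obtain ⟨m, rfl⟩ := Nat.exists_eq_add_one.2 hl.pos
    have hm : (m : ℂ) ≠ 0 := Nat.cast_ne_zero.2 (by have := hl.two_le; omega)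
    rw [h1, sum_range_succ']
    simp [powWeight, powSign, hl2, hm]
  · rintro rfl
    simp only [sum_range_succ, powSign, powWeight] at h
    rcases mul_self_eq_one_iff.1 ((sq (ψ y)).symm.trans hyl) with h1 | h1 <;>
      rcases hs with rfl | rfl <;>
      simp_all


theorem sum_prod_sum_mulChar_pow {F ι κ : Type*} [Field F] [Fintype F] [Fintype ι] [Fintype κ]
    [Nonempty κ] [DecidableEq ι] [DecidableEq κ]
    (ψ : κ → MulChar F ℂ) (m : κ → ℕ) (w : κ → ℕ → ℝ) (c : ι → F) :
    ∑ x, ∏ j : ι × κ, ∑ t ∈ range (m j.2), (w j.2 t : ℂ) * (ψ j.2 ^ t) (x + c j.1) =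
      ∑ τ ∈ Fintype.piFinset fun j : ι × κ => range (m j.2),
        ((∏ j, w j.2 (τ j) : ℝ) : ℂ) * ∑ x, ∏ i, (∏ l, ψ l ^ τ (i, l)) (x + c i) := by
  simp_rw [prod_univ_sum, prod_mul_distrib]
  rw [sum_comm]
  refine sum_congr rfl fun τ _ => ?_
  rw [mul_sum]
  refine sum_congr rfl fun x _ => ?_
  rw [Complex.ofReal_prod, Fintype.prod_prod_type (f := fun j => (ψ j.2 ^ τ j) (x + c j.1))]
  simp_rw [MulChar.prod_apply univ_nonempty]

theorem MulChar.prod_pow_ne_one {F κ : Type*} [Field F] [Fintype κ] {ψ : κ → MulChar F ℂ}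
    {m : κ → ℕ} (hm : ∀ l, (m l).Prime) (hinj : Function.Injective m)
    (hψ : ∀ l, orderOf (ψ l) = m l) {τ : κ → ℕ} (hτ : ∀ l, τ l < m l) {l : κ} (hl : τ l ≠ 0) :
    ∏ k, ψ k ^ τ k ≠ 1 := by
  classical
  intro h
  have h1 : (∏ k, ψ k ^ τ k) ^ (∏ k ∈ univ.erase l, m k) =
      ψ l ^ (τ l * ∏ k ∈ univ.erase l, m k) := by
    rw [← mul_prod_erase univ _ (mem_univ l), mul_pow, ← pow_mul, ← prod_pow]
    refine mul_eq_left.2 (prod_eq_one fun k hk => ?_)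
    rw [← mul_prod_erase _ _ hk, ← pow_mul, mul_comm (τ k), mul_assoc, pow_mul, ← hψ k,
      pow_orderOf_eq_one, one_pow]
  rw [h, one_pow] at h1
  have h2 := orderOf_dvd_of_pow_eq_one h1.symm
  rw [hψ, (hm l).dvd_mul, (hm l).prime.dvd_finsetProd_iff] at h2
  rcases h2 with h2 | ⟨k, hk, h2⟩
  · exact hl (Nat.eq_zero_of_dvd_of_lt h2 (hτ l))
  · exact (mem_erase.1 hk).1 (hinj ((Nat.prime_dvd_prime_iff_eq (hm l) (hm k)).1 h2)).symm

theorem exists_sum_prod_one_add_eq {F ι : Type*} [Field F] [Fintype F] [Fintype ι] [Nonempty ι]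
    (c : ι → F) : ∃ N : ℕ, Fintype.card F ≤ N + Fintype.card ι ∧
      ∑ x, ∏ i, (1 : MulChar F ℂ) (x + c i) = N := by
  classical
  refine ⟨#{x | ∀ i, x + c i ≠ 0}, ?_, ?_⟩
  · rw [← card_univ, ← card_filter_add_card_filter_not (s := univ) fun x => ∀ i, x + c i ≠ 0]
    refine Nat.add_le_add_left ?_ _
    refine (card_le_card (t := univ.image fun i => -c i) fun x hx => ?_).trans card_image_le
    simp only [mem_filter, mem_univ, true_and, not_forall, not_not] at hx
    obtain ⟨i, hi⟩ := hx
    exact mem_image.2 ⟨i, mem_univ _, (eq_neg_of_add_eq_zero_left hi).symm⟩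
  · rw [card_filter, Nat.cast_sum]
    refine sum_congr rfl fun x _ => ?_
    split_ifs with h
    · rw [Nat.cast_one]
      exact prod_eq_one fun i _ => MulChar.one_apply_coe (Units.mk0 _ (h i))
    · push Not at h
      obtain ⟨i, hi⟩ := h
      rw [Nat.cast_zero]
      exact prod_eq_zero (mem_univ i) (by rw [hi, MulChar.map_zero])

theorem abs_prod_powSign {κ : Type*} (s : Finset κ) (m τ : κ → ℕ) :
    |∏ j ∈ s, powSign (m j) (τ j)| = 1 := by
  rw [abs_prod]
  refine prod_eq_one fun j _ => ?_
  unfold powSign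
  split_ifs <;> simp

theorem abs_powWeight_neg_one {l : ℕ} (hl : l ≠ 0) (t : ℕ) :
    |powWeight (-1) l t| = powWeight 1 l t := by
  have : (1 : ℝ) ≤ l := by exact_mod_cast Nat.one_le_iff_ne_zero.2 hl
  unfold powWeight
  split_ifs <;> simp [this]

/-- The two systems of weights, added up over all nonzero exponents, have small total mass. -/
theorem sum_abs_prod_powWeight {κ : Type*} [Fintype κ] [DecidableEq κ] {m : κ → ℕ}
    (hm : ∀ j, (m j).Prime) {j₀ : κ} (hj₀ : m j₀ = 2) :
    ∑ τ ∈ (Fintype.piFinset fun j => range (m j)).erase 0,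
      |∏ j, powSign (m j) (τ j) * powWeight 1 (m j) (τ j) +
        ∏ j, powSign (m j) (τ j) * powWeight (-1) (m j) (τ j)| = 2 ^ Fintype.card κ - 2 := by
  have key : ∀ τ : κ → ℕ,
      |∏ j, powSign (m j) (τ j) * powWeight 1 (m j) (τ j) +
        ∏ j, powSign (m j) (τ j) * powWeight (-1) (m j) (τ j)| =
      ∏ j, powWeight 1 (m j) (τ j) + ∏ j, powWeight (-1) (m j) (τ j) := by
    intro τ
    rw [prod_mul_distrib, prod_mul_distrib, ← mul_add, abs_mul, abs_prod_powSign, one_mul]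
    refine abs_of_nonneg ?_
    have : |∏ j, powWeight (-1) (m j) (τ j)| = ∏ j, powWeight 1 (m j) (τ j) := by
      rw [abs_prod]
      exact prod_congr rfl fun j _ => abs_powWeight_neg_one (hm j).ne_zero _
    rw [← this]
    linarith [neg_abs_le (∏ j, powWeight (-1) (m j) (τ j))]
  have h0 : (0 : κ → ℕ) ∈ Fintype.piFinset fun j => range (m j) :=
    Fintype.mem_piFinset.2 fun j => mem_range.2 (hm j).pos
  have h1 : ∑ τ ∈ Fintype.piFinset fun j => range (m j), ∏ j, powWeight 1 (m j) (τ j) =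
      2 ^ Fintype.card κ := by
    rw [← prod_univ_sum, prod_congr rfl fun j _ => sum_powWeight_one (hm j), prod_const, card_univ]
  have h2 : ∑ τ ∈ Fintype.piFinset fun j => range (m j), ∏ j, powWeight (-1) (m j) (τ j) = 0 := by
    rw [← prod_univ_sum]
    exact prod_eq_zero (mem_univ j₀) (by rw [hj₀]; exact sum_powWeight_neg_one)
  rw [sum_congr rfl fun τ _ => key τ, sum_erase_eq_sub h0, sum_add_distrib, h1, h2]
  simp [powWeight]
  norm_num

theorem exists_sum_powWeight_ne_zero {F ι κ : Type*} [Field F] [Fintype F] [Fintype ι] [Fintype κ]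
    [Nonempty ι] {ψ : κ → MulChar F ℂ} {m : κ → ℕ} (hm : ∀ l, (m l).Prime)
    (hinj : Function.Injective m) (hψ : ∀ l, orderOf (ψ l) = m l) {l₀ : κ} (hl₀ : m l₀ = 2)
    {c : ι → F} (hc : Function.Injective c) (hι : Fintype.card ι < Fintype.card F)
    (hlt : (2 ^ (Fintype.card ι * Fintype.card κ) - 2) *
      (((Fintype.card ι - 1 : ℕ) : ℝ) * √(Fintype.card F)) <
        2 * ((Fintype.card F : ℝ) - Fintype.card ι)) :
    ∃ s : ℝ, (s = 1 ∨ s = -1) ∧ ∃ x, ∀ i l,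
      ∑ t ∈ range (m l), (powSign (m l) t * powWeight s (m l) t : ℝ) * (ψ l ^ t) (x + c i) ≠ 0 := by
  classical
  have : Nonempty κ := ⟨l₀⟩
  obtain ⟨i₀⟩ := ‹Nonempty ι›
  by_contra! hcon
  set T := Fintype.piFinset fun j : ι × κ => range (m j.2) with hT
  set S : (ι × κ → ℕ) → ℂ := fun τ => ∑ x, ∏ i, (∏ l, ψ l ^ τ (i, l)) (x + c i) with hS
  have hW : ∀ s : ℝ, (s = 1 ∨ s = -1) → ∑ τ ∈ T,
      ((∏ j, powSign (m j.2) (τ j) * powWeight s (m j.2) (τ j) : ℝ) : ℂ) * S τ = 0 := by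
    intro s hs
    rw [← sum_prod_sum_mulChar_pow ψ m (fun l t => powSign (m l) t * powWeight s (m l) t) c]
    refine sum_eq_zero fun x _ => ?_
    obtain ⟨i, l, h⟩ := hcon s hs x
    exact prod_eq_zero (mem_univ (i, l)) h
  have h0 : (0 : ι × κ → ℕ) ∈ T :=
    Fintype.mem_piFinset.2 fun j => mem_range.2 (hm j.2).pos
  have hsum := congrArg₂ (· + ·) (hW 1 (.inl rfl)) (hW (-1) (.inr rfl))
  simp only [← sum_add_distrib, ← add_mul, ← Complex.ofReal_add, add_zero] at hsum
  rw [← add_sum_erase _ _ h0] at hsum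
  obtain ⟨N, hN, hN'⟩ := exists_sum_prod_one_add_eq c
  have hS0 : S 0 = N := by simpa [hS] using hN'
  have hbd : ∀ τ ∈ T.erase 0, ‖S τ‖ ≤ ((Fintype.card ι - 1 : ℕ) : ℝ) * √(Fintype.card F) := by
    intro τ hτ
    obtain ⟨hτ0, hτ⟩ := mem_erase.1 hτ
    obtain ⟨⟨i, l⟩, hil⟩ := Function.ne_iff.1 hτ0
    exact norm_sum_prod_mulChar_add_le hι (χ := fun i => ∏ l, ψ l ^ τ (i, l)) hc (i₀ := i)
      (MulChar.prod_pow_ne_one hm hinj hψ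
        (fun l => mem_range.1 (Fintype.mem_piFinset.1 hτ (i, l))) hil)
  have hmass := sum_abs_prod_powWeight (m := fun j : ι × κ => m j.2) (fun j => hm j.2)
    (j₀ := (i₀, l₀)) hl₀
  rw [Fintype.card_prod] at hmass
  have hmain : (2 : ℝ) * N ≤ (2 ^ (Fintype.card ι * Fintype.card κ) - 2) *
      (((Fintype.card ι - 1 : ℕ) : ℝ) * √(Fintype.card F)) := by
    rw [← hmass, sum_mul]
    have h2 : ((2 * N : ℝ) : ℂ) = -∑ τ ∈ T.erase 0,
        ((∏ j, powSign (m j.2) (τ j) * powWeight 1 (m j.2) (τ j) +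
          ∏ j, powSign (m j.2) (τ j) * powWeight (-1) (m j.2) (τ j) : ℝ) : ℂ) * S τ := by
      rw [← eq_neg_iff_add_eq_zero.2 hsum, hS0]
      simp [powSign, powWeight]
      norm_num
    calc (2 : ℝ) * N = ‖((2 * N : ℝ) : ℂ)‖ := by
          rw [Complex.norm_real, Real.norm_of_nonneg (by positivity)]
      _ ≤ _ := by
          rw [h2, norm_neg]
          refine (norm_sum_le _ _).trans (sum_le_sum fun τ hτ => ?_)
          rw [norm_mul, Complex.norm_real, Real.norm_eq_abs]
          exact mul_le_mul_of_nonneg_left (hbd τ hτ) (abs_nonneg _)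
  have : (Fintype.card F : ℝ) ≤ N + Fintype.card ι := by exact_mod_cast hN
  linarith

theorem mul_sqrt_lt_of_bound {q n k : ℕ} (hq : 7 ≤ q) (hn : 3 ≤ n) (hk : 1 ≤ k)
    (h : (n - 1) ^ 2 * 2 ^ (2 * (k - 1)) ≤ q) :
    (2 ^ k - 2 : ℝ) * ((n - 1 : ℕ) * √q) < 2 * (q - n) := by
  obtain ⟨k, rfl⟩ := Nat.exists_eq_add_of_le' hk
  obtain ⟨n, rfl⟩ := Nat.exists_eq_add_of_le' (show 1 ≤ n by omega)
  simp only [Nat.add_sub_cancel] at h ⊢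
  have hn' : (2 : ℝ) ≤ n := by exact_mod_cast (show 2 ≤ n by omega)
  have hq' : (7 : ℝ) ≤ q := by exact_mod_cast hq
  have h1 : (n * 2 ^ k : ℝ) ≤ √q := by
    refine Real.le_sqrt_of_sq_le ?_
    rw [mul_pow, ← pow_mul, mul_comm k]
    exact_mod_cast h
  have h2 : (2 : ℝ) < √q := Real.lt_sqrt_of_sq_lt (by linarith)
  have h3 : √(q : ℝ) * √q = q := Real.mul_self_sqrt (by linarith)
  push_cast
  rw [pow_succ]
  nlinarith [mul_le_mul_of_nonneg_right h1 (Real.sqrt_nonneg q)]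

/-- If `q ≡ 3 (mod 4)`, `q ≥ 7`, `3 ≤ n ≤ p` and `q ≥ (n-1)² · 2^{2(n ω(q-1) - 1)}`,
then `𝔽_q` contains `n` consecutive primitive elements. -/
theorem consecutive_primitives_of_bound_three_mod_four (q p n : ℕ) (hq : IsPrimePow q)
    (hq4 : q % 4 = 3) (hq7 : 7 ≤ q)
    (F : Type*) [Field F] [Fintype F] (hF : Fintype.card F = q) (hp : CharP F p)
    (hn3 : 3 ≤ n) (hnp : n ≤ p)
    (hbound : (n - 1) ^ 2 * 2 ^ (2 * (n * (q - 1).primeFactors.card - 1)) ≤ q) :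
    HasConsecutivePrimitives F n := by
  have hcast : ∀ i : ℕ, i < n → ∀ j : ℕ, j < n → (i : F) = j → i = j := fun i hi j hj h =>
    CharP.natCast_injOn_Iio F p (Set.mem_Iio.2 (hi.trans_le hnp))
      (Set.mem_Iio.2 (hj.trans_le hnp)) h
  suffices h : ∃ g : F, ∀ k : ℕ, k < n → IsPrimitiveElem (g + (k : F)) by
    obtain ⟨g, hg⟩ := h
    exact ⟨g, hg, fun i hi j hj h => hcast i hi j hj (add_left_cancel h)⟩
  have hq1 : q - 1 ≠ 0 := by omega
  have h2 : 2 ∈ (q - 1).primeFactors :=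
    Nat.mem_primeFactors.2 ⟨Nat.prime_two, by omega, hq1⟩
  have hex : ∀ l : ℕ, ∃ ψ : MulChar F ℂ, l ∈ (q - 1).primeFactors → orderOf ψ = l := by
    intro l
    by_cases hl : l ∈ (q - 1).primeFactors
    · obtain ⟨ψ, hψ⟩ := MulChar.exists_mulChar_orderOf F
        (hF ▸ Nat.dvd_of_mem_primeFactors hl)
        (Complex.isPrimitiveRoot_exp l (Nat.prime_of_mem_primeFactors hl).ne_zero)
      exact ⟨ψ, fun _ => hψ⟩
    · exact ⟨1, fun h => absurd h hl⟩
  choose ψ hψ using hex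
  have hψpow : ∀ l ∈ (q - 1).primeFactors, ψ l ^ l = 1 := fun l hl => by
    conv_lhs => rw [← hψ l hl, hψ l hl]
    exact orderOf_dvd_iff_pow_eq_one.1 (hψ l hl).dvd
  have hψ2 : ψ 2 (-1) = -1 := by
    refine MulChar.apply_neg_one_eq_neg_one (hF ▸ hq4) (hψpow 2 h2) fun h => ?_
    have := hψ 2 h2
    rw [h, orderOf_one] at this
    omega
  have hpos : 1 ≤ n * (q - 1).primeFactors.card :=
    Nat.mul_pos (by omega) (card_pos.2 ⟨2, h2⟩)
  have hnq : n < q := by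
    have h1 : (n - 1) ^ 2 ≤ q :=
      (Nat.le_mul_of_pos_right _ (by positivity)).trans hbound
    obtain ⟨m, rfl⟩ := Nat.exists_eq_add_of_le' (show 1 ≤ n by omega)
    rw [Nat.add_sub_cancel] at h1
    by_contra! hle
    nlinarith
  have : Nonempty (Fin n) := ⟨⟨0, by omega⟩⟩
  obtain ⟨s, hs, x, hx⟩ := exists_sum_powWeight_ne_zero (F := F) (ι := Fin n)
    (κ := (q - 1).primeFactors) (ψ := fun l => ψ l) (m := fun l => (l : ℕ))
    (fun l => Nat.prime_of_mem_primeFactors l.2) Subtype.val_injective (fun l => hψ l l.2)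
    (l₀ := ⟨2, h2⟩) rfl (c := fun i => ((i : ℕ) : F))
    (fun i j h => Fin.ext (hcast i i.2 j j.2 h)) (by rwa [Fintype.card_fin, hF])
    (by
      rw [Fintype.card_fin, Fintype.card_coe, hF]
      exact mul_sqrt_lt_of_bound hq7 hn3 hpos hbound)
  have key : ∀ k < n, ∀ l ∈ (q - 1).primeFactors, x + (k : F) ≠ 0 ∧
      (l ≠ 2 → ψ l (x + (k : F)) ≠ 1) ∧ (l = 2 → ψ l (x + (k : F)) = s) := fun k hk l hl =>
    apply_of_sum_powWeight_ne_zero (Nat.prime_of_mem_primeFactors hl) (hψpow l hl) hs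
      (hx ⟨k, hk⟩ ⟨l, hl⟩)
  rcases hs with rfl | rfl
  · refine ⟨-(x + (n - 1 : ℕ)), fun k hk => ?_⟩
    have heq : -(x + ((n - 1 : ℕ) : F)) + k = -1 * (x + (n - 1 - k : ℕ)) := by
      rw [Nat.cast_sub (show k ≤ n - 1 by omega)]
      ring
    have hk' : n - 1 - k < n := by omega
    rw [heq]
    refine isPrimitiveElem_of_mulChar_ne_one (ψ := ψ) (hF ▸ hψpow)
      (mul_ne_zero (by simp) (key _ hk' 2 h2).1) fun l hl => ?_
    rw [hF] at hl
    rw [map_mul]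
    by_cases hl2 : l = 2
    · rw [(key _ hk' l hl).2.2 hl2, hl2, hψ2]
      norm_num
    · rw [MulChar.apply_neg_one_eq_one
        ((Nat.prime_of_mem_primeFactors hl).odd_of_ne_two hl2) (hψpow l hl), one_mul]
      exact (key _ hk' l hl).2.1 hl2
  · refine ⟨x, fun k hk => ?_⟩
    refine isPrimitiveElem_of_mulChar_ne_one (ψ := ψ) (hF ▸ hψpow)
      (key k hk 2 h2).1 fun l hl => ?_
    rw [hF] at hl
    by_cases hl2 : l = 2
    · rw [(key k hk l hl).2.2 hl2]
      norm_num
    · exact (key k hk l hl).2.1 hl2
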